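/- arXiv:2210.07520 — 3 statements merged into one kernel-verified Lean document; each statement's English description precedes it below -/
import Mathlib

section
/- Suppose k[S] is Cohen–Macaulay and (x^{a_1},…,x^{a_d}) is a reduction ideal of the maximal ideal 𝔪 = (x^{a_1},…,x^{a_{d+r}}). Let G = {f_1,…,f_t} be a minimal Gröbner basis of I(S) with respect to the negative degree reverse lexicographic order induced by z_{d+r} > ⋯ > z_1. Then the associated graded ring gr_𝔪(k[S]) is Cohen–Macaulay if and only if for every 1 ≤ j ≤ d and every 1 ≤ i ≤ t the variable z_j does not divide LM(f_i). -/
open MvPolynomial CategoryTheory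

set_option maxHeartbeats 1000000
set_option synthInstance.maxHeartbeats 400000

noncomputable section

namespace AffineSG

/-- The total degree of an exponent vector. -/
def edeg {n : ℕ} (u : Fin n →₀ ℕ) : ℕ := u.sum fun _ e => e

/-- `ndrlGT u v` means that the monomial with exponent vector `u` is strictly greater than
the one with exponent vector `v` in the negative degree reverse lexicographic order induced by
`z_n > ⋯ > z_1` (the variable with larger index is the larger variable). -/
def ndrlGT {n : ℕ} (u v : Fin n →₀ ℕ) : Prop :=
  edeg u < edeg v ∨
    (edeg u = edeg v ∧ ∃ i : Fin n, u i < v i ∧ ∀ j : Fin n, j < i → u j = v j)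

/-- `IsLM f m` : the exponent vector `m` is the leading monomial of `f` with respect to the
negative degree reverse lexicographic order. -/
def IsLM {n : ℕ} {k : Type} [Field k] (f : MvPolynomial (Fin n) k) (m : Fin n →₀ ℕ) : Prop :=
  m ∈ f.support ∧ ∀ m' ∈ f.support, m' ≠ m → ndrlGT m m'

/-- `G` is a Gröbner (standard) basis of `I` with respect to the negative degree reverse
lexicographic order: `G ⊆ I` and the leading monomial of every nonzero element of `I` is
divisible by the leading monomial of some element of `G`. -/
def IsGroebnerBasis {n : ℕ} {k : Type} [Field k] (G : Finset (MvPolynomial (Fin n) k))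
    (I : Ideal (MvPolynomial (Fin n) k)) : Prop :=
  (↑G : Set (MvPolynomial (Fin n) k)) ⊆ (I : Set (MvPolynomial (Fin n) k)) ∧
    ∀ f ∈ I, f ≠ 0 → ∃ g ∈ G, ∃ mg mf, IsLM g mg ∧ IsLM f mf ∧ mg ≤ mf

/-- A minimal Gröbner basis: a Gröbner basis consisting of nonzero polynomials no leading
monomial of which divides the leading monomial of another element. -/
def IsMinimalGroebnerBasis {n : ℕ} {k : Type} [Field k] (G : Finset (MvPolynomial (Fin n) k))
    (I : Ideal (MvPolynomial (Fin n) k)) : Prop :=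
  IsGroebnerBasis G I ∧ (0 : MvPolynomial (Fin n) k) ∉ G ∧
    ∀ g ∈ G, ∀ g' ∈ G, g ≠ g' → ∀ mg mg', IsLM g mg → IsLM g' mg' → ¬ mg ≤ mg'

/-- The toric ideal (defining ideal) attached to a family `g` of lattice points in `ℕ^d`:
the kernel of `z_i ↦ x^{g i}`. -/
def famIdeal (k : Type) [Field k] {n d : ℕ} (g : Fin n → (Fin d → ℕ)) :
    Ideal (MvPolynomial (Fin n) k) :=
  RingHom.ker (MvPolynomial.aeval
    (fun i => MvPolynomial.monomial (Finsupp.equivFunOnFinite.symm (g i)) (1 : k)) :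
      MvPolynomial (Fin n) k →ₐ[k] MvPolynomial (Fin d) k)

/-- A simplicial affine semigroup fully embedded in `ℕ^d`, minimally generated by
`gen 0, …, gen (d+r-1)`, whose set of extremal rays consists of the first `d` generators. -/
structure SimplicialAffineSemigroup (d r : ℕ) where
  gen : Fin (d + r) → (Fin d → ℕ)
  gen_ne_zero : ∀ i, gen i ≠ 0
  li : LinearIndependent ℚ (fun (i : Fin d) (j : Fin d) => ((gen (Fin.castAdd r i) j : ℚ)))
  cone : ∀ i : Fin (d + r), ∃ c : Fin d → ℚ, (∀ j, 0 ≤ c j) ∧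
    (fun j => (gen i j : ℚ)) = ∑ j : Fin d, c j • (fun l => (gen (Fin.castAdd r j) l : ℚ))
  minimal : ∀ i, gen i ∉ AddSubmonoid.closure (Set.range gen \ {gen i})

namespace SimplicialAffineSemigroup

variable {d r : ℕ}

/-- The underlying semigroup (as a set): the additive submonoid generated by the generators. -/
def mem (S : SimplicialAffineSemigroup d r) (s : Fin d → ℕ) : Prop :=
  s ∈ AddSubmonoid.closure (Set.range S.gen)

/-- The defining ideal `I(S)` of the semigroup ring `k[S]`. -/
def definingIdeal (k : Type) [Field k] (S : SimplicialAffineSemigroup d r) :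
    Ideal (MvPolynomial (Fin (d + r)) k) :=
  famIdeal k S.gen

end SimplicialAffineSemigroup

/-- The smallest degree of a monomial appearing in `f`. -/
def minDeg {n : ℕ} {k : Type} [Field k] (f : MvPolynomial (Fin n) k) : ℕ :=
  sInf (edeg '' (f.support : Set (Fin n →₀ ℕ)))

/-- The initial form `f*` of `f`: the homogeneous component of least degree of `f`. -/
def initialForm {n : ℕ} {k : Type} [Field k] (f : MvPolynomial (Fin n) k) :
    MvPolynomial (Fin n) k :=
  MvPolynomial.homogeneousComponent (minDeg f) f

/-- `I*`, the ideal generated by the initial forms of the elements of `I`;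
one has `gr_𝔪(A/I) ≅ A/I*`. -/
def starIdeal {n : ℕ} {k : Type} [Field k] (I : Ideal (MvPolynomial (Fin n) k)) :
    Ideal (MvPolynomial (Fin n) k) :=
  Ideal.span { g | ∃ f ∈ I, f ≠ 0 ∧ g = initialForm f }

/-- A finite set `J ⊆ I` is a standard basis of `I` if the initial forms of its elements
generate `I*`. -/
def IsStandardBasis {n : ℕ} {k : Type} [Field k] (J : Finset (MvPolynomial (Fin n) k))
    (I : Ideal (MvPolynomial (Fin n) k)) : Prop :=
  (↑J : Set (MvPolynomial (Fin n) k)) ⊆ (I : Set (MvPolynomial (Fin n) k)) ∧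
    starIdeal I = Ideal.span (initialForm '' (↑J : Set (MvPolynomial (Fin n) k)))

/-- The ideal of a commutative ring generated by the images of the variables under the
quotient map; for `A/I` this is the distinguished (graded) maximal ideal `𝔪`. -/
def quotMax {n : ℕ} {k : Type} [Field k] (I : Ideal (MvPolynomial (Fin n) k)) :
    Ideal (MvPolynomial (Fin n) k ⧸ I) :=
  Ideal.map (Ideal.Quotient.mk I) (Ideal.span (Set.range (MvPolynomial.X : Fin n → MvPolynomial (Fin n) k)))

/-- `J` is a reduction ideal of `I`: `J ⊆ I` and `J I^n = I^{n+1}` for all large `n`. -/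
def IsReductionIdeal {R : Type} [CommRing R] (J I : Ideal R) : Prop :=
  J ≤ I ∧ ∃ N : ℕ, ∀ n ≥ N, J * I ^ n = I ^ (n + 1)

/-- A commutative ring `R` with distinguished (maximal) ideal `m` is Cohen–Macaulay if
there is a regular sequence on `R` consisting of elements of `m` whose length is the Krull
dimension of `R`. -/
def IsCM (R : Type) [CommRing R] (m : Ideal R) : Prop :=
  ∃ rs : List R, (∀ x ∈ rs, x ∈ m) ∧ RingTheory.Sequence.IsRegular R rs ∧
    ringKrullDim R = rs.length

/-- The depth of `R` with respect to the ideal `m`: the supremum of the lengths of regular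
sequences on `R` consisting of elements of `m`. -/
def ringDepth (R : Type) [CommRing R] (m : Ideal R) : ℕ∞ :=
  sSup ((fun rs : List R => (rs.length : ℕ∞)) ''
    { rs : List R | (∀ x ∈ rs, x ∈ m) ∧ RingTheory.Sequence.IsRegular R rs })

/-- The length of a module, realized as the Krull dimension of its lattice of submodules. -/
def moduleLength (R M : Type) [CommRing R] [AddCommGroup M] [Module R M] : WithBot ℕ∞ :=
  Order.krullDim (Submodule R M)

/-- The `i`-th Betti number of the `R`-module `M` with respect to the distinguished maximal
ideal `m`, namely the length of `Tor_i^R(R/m, M)`. -/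
def bettiNumber (R : Type) [CommRing R] (m : Ideal R) (M : Type) [AddCommGroup M] [Module R M]
    (i : ℕ) : WithBot ℕ∞ :=
  moduleLength R (((Tor (ModuleCat R) i).obj (ModuleCat.of R (R ⧸ m))).obj (ModuleCat.of R M))

/-- The height of an ideal. -/
def idealHeight {R : Type} [CommRing R] (I : Ideal R) : ℕ∞ :=
  sInf { n : ℕ∞ | ∃ p : PrimeSpectrum R, I ≤ p.asIdeal ∧ n = Order.height p }

/-- The minimal number of generators of an ideal. -/
def mu {R : Type} [CommRing R] (I : Ideal R) : ℕ∞ :=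
  sInf { n : ℕ∞ | ∃ s : Finset R, (s.card : ℕ∞) = n ∧ Ideal.span (↑s : Set R) = I }

/-- An ideal `I` of a polynomial ring is a complete intersection if its height equals its
minimal number of generators. -/
def IsCompleteIntersectionIdeal {R : Type} [CommRing R] (I : Ideal R) : Prop :=
  idealHeight I = mu I


/-- `p` is a factorization of `s` in terms of the generating family `g`. -/
def FamFactorization {n d : ℕ} (g : Fin n → (Fin d → ℕ)) (p : Fin n → ℕ) (s : Fin d → ℕ) :
    Prop :=
  ∑ i, p i • g i = s

/-- `s` belongs to the affine semigroup generated by the family `g`. -/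
def FamMem {n d : ℕ} (g : Fin n → (Fin d → ℕ)) (s : Fin d → ℕ) : Prop :=
  ∃ p, FamFactorization g p s

/-- `s` belongs to the Apéry set `AP(S,E)` of the semigroup generated by `g`, where the set of
extremal rays `E` consists of the first `d` members of the family. -/
def FamApery {d m : ℕ} (g : Fin (d + m) → (Fin d → ℕ)) (s : Fin d → ℕ) : Prop :=
  FamMem g s ∧ ∀ i : Fin d, ¬ ∃ t, FamMem g t ∧ t + g (Fin.castAdd m i) = s

/-- The semigroup generated by `g` (first `d` members extremal rays) is homogeneous: every
nonzero element of the Apéry set with respect to the extremal rays has all its factorizations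
of the same length. -/
def FamHomogeneous {d m : ℕ} (g : Fin (d + m) → (Fin d → ℕ)) : Prop :=
  ∀ s, FamApery g s → s ≠ 0 → ∀ p q, FamFactorization g p s → FamFactorization g q s →
    ∑ i, p i = ∑ i, q i

/-- `p` is a maximal factorization: no factorization of the same semigroup element has
strictly larger length (so the length of `p` is the order of the element). -/
def IsMaximalFactorization {n d : ℕ} (g : Fin n → (Fin d → ℕ)) (p : Fin n → ℕ) : Prop :=
  ∀ q, FamFactorization g q (∑ i, p i • g i) → ∑ i, q i ≤ ∑ i, p i

/-- The projection `π_e` killing the `e` smallest variables `z_1, …, z_e`. -/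
def proj (k : Type) [Field k] (n e : ℕ) :
    MvPolynomial (Fin n) k →ₐ[k] MvPolynomial (Fin (n - e)) k :=
  MvPolynomial.aeval fun j : Fin n =>
    if hj : e ≤ (j : ℕ) then
      MvPolynomial.X (⟨(j : ℕ) - e, by have := j.isLt; omega⟩ : Fin (n - e))
    else 0

/-- The generating family of the extension `S_b = λS ∪ {μb}` of the semigroup generated by
`g`, where `b = Σ α_i g i`. -/
def extFam {d r : ℕ} (g : Fin (d + r) → (Fin d → ℕ)) (α : Fin (d + r) → ℕ) (lam mu : ℕ) :
    Fin (d + (r + 1)) → (Fin d → ℕ) :=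
  Fin.snoc (fun i => lam • g i) (mu • ∑ i, α i • g i)

/-- Generating families of simplicial affine semigroups obtained from `ℕ^d` by a finite
sequence of nice extensions. -/
inductive NiceSeq (d : ℕ) : ∀ r : ℕ, (Fin (d + r) → (Fin d → ℕ)) → Prop
  | base : NiceSeq d 0 (fun i j => if (i : ℕ) = (j : ℕ) then 1 else 0)
  | step {r : ℕ} {g : Fin (d + r) → (Fin d → ℕ)} (α : Fin (d + r) → ℕ) (lam mu : ℕ)
      (hg : NiceSeq d r g) (hco : Nat.Coprime lam mu) (hnice : lam ≤ ∑ i, α i) :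
      NiceSeq d (r + 1) (extFam g α lam mu)


/-- The ideal of `A/I` generated by the images of the variables corresponding to the
extremal rays (the first `d` variables). -/
def quotExtremal (d r : ℕ) (k : Type) [Field k] (I : Ideal (MvPolynomial (Fin (d + r)) k)) :
    Ideal (MvPolynomial (Fin (d + r)) k ⧸ I) :=
  Ideal.map (Ideal.Quotient.mk I)
    (Ideal.span (Set.range fun i : Fin d =>
      (MvPolynomial.X (Fin.castAdd r i) : MvPolynomial (Fin (d + r)) k)))

end AffineSG

section CommAlg

open RingTheory.Sequence IsLocalRing Abelian
open scoped Pointwise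

theorem ringKrullDim_eq_of_isIntegral_of_injective {R S : Type*} [CommRing R] [CommRing S]
    [Algebra R S] [Algebra.IsIntegral R S] (h : Function.Injective (algebraMap R S)) :
    ringKrullDim S = ringKrullDim R := by
  apply le_antisymm
  · exact Order.krullDim_le_of_strictMono (PrimeSpectrum.comap (algebraMap R S))
      fun p q hpq => Ideal.IsIntegral.comap_lt_comap (I := p.asIdeal) (J := q.asIdeal) hpq
  · refine iSup_le fun l => ?_
    obtain ⟨Q, -, hQ, hQ'⟩ := Ideal.exists_ideal_over_prime_of_isIntegral (S := S)
      (RelSeries.head l).asIdeal ⊥ (by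
        rw [← RingHom.ker_eq_comap_bot, (RingHom.injective_iff_ker_eq_bot _).1 h]; exact bot_le)
    have : Q.LiesOver (RelSeries.head l).asIdeal := ⟨hQ'.symm⟩
    obtain ⟨L, hL, -⟩ := Ideal.exists_ltSeries_of_hasGoingUp l Q
    rw [← hL]
    exact le_iSup (fun p : LTSeries (PrimeSpectrum S) => (p.length : WithBot ℕ∞)) L

/-- Quotienting by a regular element lowers the depth by at most one. -/
theorem exists_isRegular_quotSMulTop {R : Type} [CommRing R] [IsNoetherianRing R] [IsLocalRing R]
    {M : Type} [AddCommGroup M] [Module R M] [Module.Finite R M] [Nontrivial M] {z : R}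
    (hz : z ∈ maximalIdeal R) (hreg : IsSMulRegular M z) {ys : List R}
    (hys : ∀ y ∈ ys, y ∈ maximalIdeal R) (hyr : IsRegular M ys) {n : ℕ} (hn : ys.length = n + 1) :
    ∃ ws : List R, ws.length = n ∧ (∀ w ∈ ws, w ∈ maximalIdeal R) ∧
      IsRegular (QuotSMulTop z M) ws := by
  have lt (N : Type) [AddCommGroup N] [Module R N] [Module.Finite R N] [Nontrivial N] :
      maximalIdeal R • (⊤ : Submodule R N) < ⊤ :=
    lt_of_le_of_ne le_top (Submodule.top_ne_ideal_smul_of_le_jacobson_annihilator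
      (maximalIdeal_le_jacobson _)).symm
  have := nontrivial_quotSMulTop_of_mem_maximalIdeal M hz
  refine ((ModuleCat.exists_isRegular_tfae (maximalIdeal R) n
    (ModuleCat.of R (QuotSMulTop z M)) (lt _)).out 3 1).2 ?_
  have h := ((ModuleCat.exists_isRegular_tfae (maximalIdeal R) (n + 1)
    (ModuleCat.of R M) (lt _)).out 3 1 rfl rfl).1 ⟨ys, hn, hys, hyr⟩
  intro i hi
  have zero1 := AddCommGrpCat.isZero_of_iff_subsingleton.mpr (h i (by omega))
  have zero2 := AddCommGrpCat.isZero_of_iff_subsingleton.mpr (h (i + 1) (by omega))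
  exact AddCommGrpCat.subsingleton_of_isZero <| ShortComplex.Exact.isZero_of_both_zeros
    ((Ext.covariant_sequence_exact₃' _ (IsSMulRegular.smulShortComplex_shortExact
      (M := ModuleCat.of R M) hreg) i (i + 1) rfl))
    (zero1.eq_zero_of_src _) (zero2.eq_zero_of_tgt _)

/-- The depth of a module is bounded by the dimension of `R ⧸ p` for each associated prime `p`. -/
theorem length_le_ringKrullDim_quotient_of_mem_associatedPrimes {R : Type*} [CommRing R]
    [IsNoetherianRing R] [IsLocalRing R] (ys : List R) :
    ∀ {M : Type*} [AddCommGroup M] [Module R M] [Module.Finite R M]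
    (_ : ∀ y ∈ ys, y ∈ maximalIdeal R) (_ : IsRegular M ys)
    {p : Ideal R} (_ : p ∈ associatedPrimes R M),
    (ys.length : WithBot ℕ∞) ≤ ringKrullDim (R ⧸ p) := by
  induction ys with
  | nil =>
    intro M _ _ _ _ _ p hp
    have := hp.1
    have : Nontrivial (R ⧸ p) := Ideal.Quotient.nontrivial_iff.2 hp.1.ne_top
    simpa using ringKrullDim_nonneg_of_nontrivial
  | cons y ys ih =>
    intro M _ _ _ hys hreg p hp
    obtain ⟨hy, hreg'⟩ := (isRegular_cons_iff M y ys).1 hreg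
    have hpp : p.IsPrime := hp.1
    obtain ⟨-, m, hm⟩ := (isAssociatedPrime_iff).1 hp
    have hm0 : m ≠ 0 := by
      rintro rfl
      apply hpp.ne_top
      rw [hm, Ideal.eq_top_iff_one]
      simp [Submodule.mem_colon_singleton]
    have hyp : y ∉ p := by
      intro h
      rw [hm] at h
      simp only [Submodule.mem_colon_singleton, Submodule.mem_bot] at h
      exact hm0 (hy (by simpa using h))
    let N : Submodule R M :=
      { carrier := {x | ∀ a ∈ p, a • x = 0}
        add_mem' := fun {a b} ha hb c hc => by simp [smul_add, ha c hc, hb c hc]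
        zero_mem' := fun c _ => smul_zero c
        smul_mem' := fun c x hx a ha => by rw [smul_comm, hx a ha, smul_zero] }
    have hmN : m ∈ N := by
      intro a ha
      rw [hm] at ha
      simpa [Submodule.mem_colon_singleton] using ha
    have hN : ¬ N ≤ y • (⊤ : Submodule R M) := by
      intro hle
      have : N = ⊥ := by
        refine Submodule.eq_bot_of_le_smul_of_le_jacobson_bot (Ideal.span {y}) N
          (IsNoetherian.noetherian _) ?_ ?_
        · intro x hx
          obtain ⟨x', -, rfl⟩ := (Submodule.mem_smul_pointwise_iff_exists _ _ _).1 (hle hx)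
          refine Submodule.smul_mem_smul (Ideal.mem_span_singleton_self y) fun a ha => ?_
          apply hy
          change y • a • x' = y • (0 : M)
          rw [smul_comm, smul_zero]
          exact hx a ha
        · rw [IsLocalRing.jacobson_eq_maximalIdeal _ bot_ne_top, Ideal.span_singleton_le_iff_mem]
          exact hys y (by simp)
      rw [this] at hmN
      exact hm0 hmN
    obtain ⟨x, hxN, hx⟩ := SetLike.not_le_iff_exists.1 hN
    let xb : QuotSMulTop y M := Submodule.Quotient.mk x
    have hxb : xb ≠ 0 := fun h => hx ((Submodule.Quotient.mk_eq_zero _).1 h)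
    obtain ⟨q, hq, hqx⟩ := exists_le_isAssociatedPrime_of_isNoetherianRing R xb hxb
    have hpq : p ≤ q := fun a ha => hqx (by
      rw [Submodule.mem_colon_singleton, Submodule.mem_bot, ← Submodule.Quotient.mk_smul, hxN a ha]
      rfl)
    have hyq : y ∈ q := hqx (by
      rw [Submodule.mem_colon_singleton, Submodule.mem_bot, ← Submodule.Quotient.mk_smul,
        Submodule.Quotient.mk_eq_zero]
      exact Submodule.smul_mem_pointwise_smul _ _ _ trivial)
    have h1 := ih (fun y hy => hys y (by simp [hy])) hreg' hq
    have h2 : ringKrullDim (R ⧸ q) + 1 ≤ ringKrullDim (R ⧸ p) := by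
      refine ringKrullDim_succ_le_of_surjective (Ideal.Quotient.factor hpq)
        (Ideal.Quotient.factor_surjective hpq) (r := Ideal.Quotient.mk p y) ?_ ?_
      · rw [mem_nonZeroDivisors_iff_ne_zero]
        exact fun h => hyp (Ideal.Quotient.eq_zero_iff_mem.1 h)
      · simpa using Ideal.Quotient.eq_zero_iff_mem.2 hyq
    refine le_trans ?_ h2
    simp only [List.length_cons, Nat.cast_add, Nat.cast_one]
    gcongr

/-- In a Noetherian local ring, if the quotient of `R` by a prime is cut down to the closed point
by a list of elements, then its dimension is at most the length of the list. -/
theorem ringKrullDim_quotient_le_length {R : Type*} [CommRing R] [IsNoetherianRing R]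
    [IsLocalRing R] (p : Ideal R) [p.IsPrime] (zs : List R) (hzs : ∀ z ∈ zs, z ∈ maximalIdeal R)
    (h : ∀ q : Ideal R, q.IsPrime → p ≤ q → (∀ z ∈ zs, z ∈ q) → q = maximalIdeal R) :
    ringKrullDim (R ⧸ p) ≤ zs.length := by
  classical
  have : IsLocalRing (R ⧸ p) := IsLocalRing.of_surjective' _ Ideal.Quotient.mk_surjective
  let s : Finset (R ⧸ p) := (zs.map (Ideal.Quotient.mk p)).toFinset
  have hs : (s : Set (R ⧸ p)) ⊆ Ring.jacobson (R ⧸ p) := by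
    rw [IsLocalRing.ringJacobson_eq_maximalIdeal]
    intro x hx
    simp only [s, List.coe_toFinset, List.mem_map, Set.mem_ofPred_eq] at hx
    obtain ⟨z, hz, rfl⟩ := hx
    have : IsLocalHom (Ideal.Quotient.mk p) :=
      IsLocalHom.of_surjective _ Ideal.Quotient.mk_surjective
    exact map_mem_nonunits_iff (Ideal.Quotient.mk p) z |>.2 (hzs z hz)
  refine (ringKrullDim_le_ringKrullDim_quotient_add_card s hs).trans ?_
  have h0 : ringKrullDim ((R ⧸ p) ⧸ Ideal.span (s : Set (R ⧸ p))) ≤ 0 := by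
    rw [ringKrullDim_quotient]
    have : Subsingleton (PrimeSpectrum.zeroLocus (R := R ⧸ p)
        (Ideal.span (s : Set (R ⧸ p)) : Set (R ⧸ p))) := by
      refine ⟨fun a b => ?_⟩
      have key : ∀ a : PrimeSpectrum.zeroLocus (R := R ⧸ p)
          (Ideal.span (s : Set (R ⧸ p)) : Set (R ⧸ p)),
          a.1.asIdeal.comap (Ideal.Quotient.mk p) = maximalIdeal R := by
        intro a
        refine h _ inferInstance ?_ ?_
        · intro x hx
          rw [Ideal.mem_comap, Ideal.Quotient.eq_zero_iff_mem.2 hx]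
          exact zero_mem _
        · intro z hz
          exact a.2 (Ideal.subset_span (by
            simp only [s, List.coe_toFinset, List.mem_map, Set.mem_ofPred_eq]
            exact ⟨z, hz, rfl⟩))
      refine Subtype.ext (PrimeSpectrum.ext
        (Ideal.comap_injective_of_surjective _ Ideal.Quotient.mk_surjective ?_))
      rw [key a, key b]
    exact Order.krullDim_nonpos_of_subsingleton
  have hc : s.card ≤ zs.length := (List.toFinset_card_le _).trans (by simp)
  calc _ ≤ (0 : WithBot ℕ∞) + (s.card : WithBot ℕ∞) := by gcongr
    _ ≤ _ := by rw [zero_add]; exact_mod_cast hc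

/-- A system of parameters on a Cohen–Macaulay module over a local ring is weakly regular. -/
theorem isWeaklyRegular_of_support_eq_closedPoint {R : Type} [CommRing R] [IsNoetherianRing R]
    [IsLocalRing R] (zs : List R) :
    ∀ {M : Type} [AddCommGroup M] [Module R M] [Module.Finite R M] [Nontrivial M]
    (_ : ∀ z ∈ zs, z ∈ maximalIdeal R)
    (_ : ∀ q : Ideal R, q.IsPrime → Module.annihilator R M ≤ q → (∀ z ∈ zs, z ∈ q) →
      q = maximalIdeal R)
    {ys : List R} (_ : ∀ y ∈ ys, y ∈ maximalIdeal R) (_ : IsRegular M ys)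
    (_ : ys.length = zs.length), IsWeaklyRegular M zs := by
  induction zs with
  | nil => intros; exact IsWeaklyRegular.nil _ _
  | cons z zs ih =>
    intro M _ _ _ _ hzs hq ys hys hreg hlen
    have hz : IsSMulRegular M z := by
      by_contra hz
      have : z ∈ ⋃ p ∈ associatedPrimes R M, (p : Set R) := by
        rw [biUnion_associatedPrimes_eq_zero_divisors]
        simp only [IsSMulRegular, Function.Injective] at hz
        push Not at hz
        obtain ⟨a, b, hab, hne⟩ := hz
        exact ⟨a - b, sub_ne_zero.2 hne, by simpa [smul_sub, sub_eq_zero] using hab⟩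
      simp only [Set.mem_iUnion, SetLike.mem_coe, exists_prop] at this
      obtain ⟨p, hp, hzp⟩ := this
      have hpp : p.IsPrime := hp.1
      have h1 := length_le_ringKrullDim_quotient_of_mem_associatedPrimes ys hys hreg hp
      have h2 := ringKrullDim_quotient_le_length p zs (fun z hz => hzs z (by simp [hz])) (by
        intro q hqp hpq hzq
        refine hq q hqp (Submodule.annihilator_top (R := R) (M := M) ▸
          (IsAssociatedPrime.annihilator_le hp).trans hpq) ?_
        simpa using ⟨hpq hzp, hzq⟩)
      have h3 := h1.trans h2
      rw [hlen] at h3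
      have : (z :: zs).length ≤ zs.length := by exact_mod_cast h3
      simp at this
    have hzm := hzs z (by simp)
    have := nontrivial_quotSMulTop_of_mem_maximalIdeal M hzm
    obtain ⟨ws, hwl, hw, hwr⟩ := exists_isRegular_quotSMulTop hzm hz hys hreg
      (n := zs.length) (by simpa using hlen)
    refine (isWeaklyRegular_cons_iff M z zs).2 ⟨hz, ih (fun z hz => hzs z (by simp [hz])) ?_
      hw hwr hwl⟩
    intro q hqp hann hzq
    refine hq q hqp ?_ ?_
    · exact (LinearMap.annihilator_le_of_surjective (R := R) _
        (Submodule.mkQ_surjective (z • (⊤ : Submodule R M)))).trans hann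
    · simp only [List.mem_cons, forall_eq_or_imp]
      refine ⟨hann (Module.mem_annihilator.2 fun x => ?_), hzq⟩
      obtain ⟨x, rfl⟩ := Submodule.Quotient.mk_surjective _ x
      rw [← Submodule.Quotient.mk_smul, Submodule.Quotient.mk_eq_zero]
      exact Submodule.smul_mem_pointwise_smul _ _ _ trivial

theorem isWeaklyRegular_ofFn_iff {R : Type*} [CommRing R] {d : ℕ} (z : Fin d → R) :
    RingTheory.Sequence.IsWeaklyRegular R (List.ofFn z) ↔
      ∀ i x, z i * x ∈ Ideal.span (z '' {i' | i' < i}) → x ∈ Ideal.span (z '' {i' | i' < i}) := by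
  have htake : ∀ i : Fin d, Ideal.ofList ((List.ofFn z).take i) =
      Ideal.span (z '' {i' | i' < i}) := by
    intro i
    refine congrArg Ideal.span (Set.ext fun x => ?_)
    simp only [Set.mem_ofPred_eq, List.mem_take_iff_getElem, List.getElem_ofFn, List.length_ofFn,
      Set.mem_image]
    constructor
    · rintro ⟨l, hl, rfl⟩
      exact ⟨⟨l, by omega⟩, by rw [Fin.lt_def]; exact (lt_min_iff.1 hl).1, rfl⟩
    · rintro ⟨l, hl, rfl⟩
      exact ⟨l, lt_min_iff.2 ⟨hl, l.2⟩, rfl⟩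
  rw [RingTheory.Sequence.isWeaklyRegular_iff]
  simp only [List.length_ofFn, List.getElem_ofFn, isSMulRegular_quotient_iff_mem_of_smul_mem,
    smul_eq_mul, Ideal.mul_top]
  exact ⟨fun h i => by simpa only [htake] using h i i.2,
    fun h i hi => by simpa only [htake ⟨i, hi⟩] using h ⟨i, hi⟩⟩

end CommAlg

namespace AffineSG

section Graded

variable {n : ℕ} {k : Type} [Field k]

theorem homogeneousComponent_mul_of_isHomogeneous {F : MvPolynomial (Fin n) k} {t : ℕ}
    (hF : F.IsHomogeneous t) (a : MvPolynomial (Fin n) k) (e : ℕ) :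
    homogeneousComponent e (a * F) =
      if t ≤ e then homogeneousComponent (e - t) a * F else 0 := by
  conv_lhs => rw [← sum_homogeneousComponent a, Finset.sum_mul, map_sum]
  have h : ∀ i, homogeneousComponent e (homogeneousComponent i a * F) =
      if i + t = e then homogeneousComponent i a * F else 0 := fun i =>
    homogeneousComponent_of_mem (by
      rw [mem_homogeneousSubmodule]
      exact (homogeneousComponent_isHomogeneous i a).mul hF) |>.trans (by simp [eq_comm])
  simp only [h]
  split_ifs with hte
  · rw [Finset.sum_eq_single (e - t)]
    · simp [Nat.sub_add_cancel hte]
    · intro b _ hb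
      rw [if_neg (by omega)]
    · intro hb
      rw [if_pos (Nat.sub_add_cancel hte), homogeneousComponent_eq_zero, zero_mul]
      rw [Finset.mem_range] at hb
      omega
  · exact Finset.sum_eq_zero fun i _ => if_neg (by omega)

theorem homogeneousComponent_X_mul (j : Fin n) (f : MvPolynomial (Fin n) k) (e : ℕ) :
    homogeneousComponent (e + 1) (X j * f) = X j * homogeneousComponent e f := by
  rw [mul_comm, homogeneousComponent_mul_of_isHomogeneous (isHomogeneous_X k j),
    if_pos (by omega), mul_comm]
  simp

/-- An ideal which contains the homogeneous components of all its elements. -/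
def IsHomogeneousIdeal (J : Ideal (MvPolynomial (Fin n) k)) : Prop :=
  ∀ f ∈ J, ∀ e, homogeneousComponent e f ∈ J

theorem isHomogeneous_initialForm (f : MvPolynomial (Fin n) k) :
    (initialForm f).IsHomogeneous (minDeg f) :=
  homogeneousComponent_isHomogeneous _ _

theorem isHomogeneousIdeal_starIdeal (I : Ideal (MvPolynomial (Fin n) k)) :
    IsHomogeneousIdeal (starIdeal I) := by
  intro F hF e
  induction hF using Submodule.closure_induction with
  | zero => simp
  | add x y _ _ hx hy => rw [map_add]; exact add_mem hx hy
  | smul_mem a x hx =>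
    obtain ⟨f, hf, hf0, rfl⟩ := hx
    rw [smul_eq_mul, homogeneousComponent_mul_of_isHomogeneous (isHomogeneous_initialForm f)]
    split_ifs
    · exact Ideal.mul_mem_left _ _ (Ideal.subset_span ⟨f, hf, hf0, rfl⟩)
    · exact zero_mem _

theorem isHomogeneousIdeal_span_X (s : Set (Fin n)) :
    IsHomogeneousIdeal (Ideal.span (X '' s : Set (MvPolynomial (Fin n) k))) := by
  intro f hf e
  rw [mem_ideal_span_X_image] at hf ⊢
  intro m hm
  rw [support_homogeneousComponent] at hm
  exact hf m (Finset.mem_filter.1 hm).1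

theorem IsHomogeneousIdeal.sup {J K : Ideal (MvPolynomial (Fin n) k)}
    (hJ : IsHomogeneousIdeal J) (hK : IsHomogeneousIdeal K) : IsHomogeneousIdeal (J ⊔ K) := by
  intro f hf e
  obtain ⟨a, ha, b, hb, rfl⟩ := Submodule.mem_sup.1 hf
  rw [map_add]
  exact add_mem (Ideal.mem_sup_left (hJ a ha e)) (Ideal.mem_sup_right (hK b hb e))

theorem homogeneousComponent_eq_zero_of_lt_minDeg {f : MvPolynomial (Fin n) k} {e : ℕ}
    (he : e < minDeg f) : homogeneousComponent e f = 0 := by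
  ext u
  rw [coeff_homogeneousComponent, coeff_zero, ite_eq_right_iff]
  intro hu
  by_contra hne
  have : minDeg f ≤ edeg u := Nat.sInf_le ⟨u, by simpa using hne, rfl⟩
  have h2 : edeg u = e := hu
  omega

/-- Each homogeneous component of an element of `I*` is zero or the lowest form of an element
of `I`. -/
theorem exists_homogeneousComponent_eq_of_mem_starIdeal {I : Ideal (MvPolynomial (Fin n) k)}
    {F : MvPolynomial (Fin n) k} (hF : F ∈ starIdeal I) (e : ℕ) :
    ∃ f ∈ I, homogeneousComponent e f = homogeneousComponent e F ∧
      ∀ m < e, homogeneousComponent m f = 0 := by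
  induction hF using Submodule.closure_induction with
  | zero => exact ⟨0, zero_mem _, rfl, fun _ _ => map_zero _⟩
  | add x y _ _ hx hy =>
    obtain ⟨f, hf, hfe, hf0⟩ := hx
    obtain ⟨g, hg, hge, hg0⟩ := hy
    exact ⟨f + g, add_mem hf hg, by simp [hfe, hge], fun m hm => by simp [hf0 m hm, hg0 m hm]⟩
  | smul_mem a x hx =>
    obtain ⟨f, hf, hf0, rfl⟩ := hx
    rw [smul_eq_mul, homogeneousComponent_mul_of_isHomogeneous (isHomogeneous_initialForm f)]
    split_ifs with h
    · have hH := homogeneousComponent_isHomogeneous (e - minDeg f) a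
      refine ⟨homogeneousComponent (e - minDeg f) a * f, Ideal.mul_mem_left _ _ hf, ?_, ?_⟩
      · rw [mul_comm, homogeneousComponent_mul_of_isHomogeneous hH, if_pos (by omega),
          mul_comm, Nat.sub_sub_self h, initialForm]
      · intro m hm
        rw [mul_comm, homogeneousComponent_mul_of_isHomogeneous hH]
        split_ifs
        · rw [homogeneousComponent_eq_zero_of_lt_minDeg (by omega), zero_mul]
        · rfl
    · exact ⟨0, zero_mem _, map_zero _, fun _ _ => map_zero _⟩

end Graded

section MonomialOrder

variable {n : ℕ} {k : Type} [Field k]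

/-- The negative degree reverse lexicographic order is the reverse of the order by this key. -/
def key (u : Fin n →₀ ℕ) : ℕ ×ₗ Lex (Fin n →₀ ℕ) := toLex (edeg u, toLex u)

theorem key_injective : Function.Injective (key (n := n)) := fun u v h => by
  simpa [key] using (congrArg (fun x => (ofLex x).2) h)

theorem ndrlGT_iff {u v : Fin n →₀ ℕ} : ndrlGT u v ↔ key u < key v := by
  rw [ndrlGT, key, key, Prod.Lex.lt_iff]
  simp only [ofLex_toLex, Finsupp.Lex.lt_iff]
  refine or_congr Iff.rfl (and_congr Iff.rfl (exists_congr fun i => ?_))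
  exact and_comm

theorem edeg_eq_degree (u : Fin n →₀ ℕ) : edeg u = u.degree := rfl

theorem edeg_add (u v : Fin n →₀ ℕ) : edeg (u + v) = edeg u + edeg v := by
  simp [edeg_eq_degree]

theorem key_add_lt_add {u v : Fin n →₀ ℕ} (h : key u < key v) (w : Fin n →₀ ℕ) :
    key (w + u) < key (w + v) := by
  rw [← ndrlGT_iff] at h ⊢
  rcases h with h | ⟨h, i, hi, hij⟩
  · exact Or.inl (by rw [edeg_add, edeg_add]; omega)
  · exact Or.inr ⟨by rw [edeg_add, edeg_add]; omega, i, by simpa using hi,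
      fun j hj => by simp [hij j hj]⟩

theorem edeg_le_of_key_le {u v : Fin n →₀ ℕ} (h : key u ≤ key v) : edeg u ≤ edeg v := by
  rcases h.lt_or_eq with h | h
  · rcases ndrlGT_iff.2 h with h | h
    · exact h.le
    · exact h.1.le
  · rw [key_injective h]

theorem isLM_iff {f : MvPolynomial (Fin n) k} {m : Fin n →₀ ℕ} :
    IsLM f m ↔ coeff m f ≠ 0 ∧ ∀ u, coeff u f ≠ 0 → key m ≤ key u := by
  simp only [IsLM, mem_support_iff, ndrlGT_iff]
  refine and_congr Iff.rfl (forall_congr' fun u => imp_congr_right fun _ => ?_)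
  constructor
  · intro h
    by_cases hu : u = m
    · rw [hu]
    · exact (h hu).le
  · exact fun h hu => lt_of_le_of_ne h fun e => hu (key_injective e).symm

theorem exists_isLM {f : MvPolynomial (Fin n) k} (hf : f ≠ 0) : ∃ m, IsLM f m := by
  obtain ⟨m, hm, h⟩ := f.support.exists_min_image key (support_nonempty.2 hf)
  exact ⟨m, isLM_iff.2 ⟨by simpa using hm, fun u hu => h u (by simpa using hu)⟩⟩

theorem IsLM.unique {f : MvPolynomial (Fin n) k} {m m' : Fin n →₀ ℕ} (h : IsLM f m)
    (h' : IsLM f m') : m = m' :=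
  key_injective (le_antisymm ((isLM_iff.1 h).2 _ (isLM_iff.1 h').1)
    ((isLM_iff.1 h').2 _ (isLM_iff.1 h).1))

theorem IsLM.minDeg_eq {f : MvPolynomial (Fin n) k} {m : Fin n →₀ ℕ} (h : IsLM f m) :
    minDeg f = edeg m := by
  apply le_antisymm
  · exact Nat.sInf_le ⟨m, h.1, rfl⟩
  · refine le_csInf ⟨_, m, h.1, rfl⟩ ?_
    rintro _ ⟨u, hu, rfl⟩
    exact edeg_le_of_key_le ((isLM_iff.1 h).2 u (by simpa using hu))

theorem coeff_homogeneousComponent' (e : ℕ) (f : MvPolynomial (Fin n) k) (u : Fin n →₀ ℕ) :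
    coeff u (homogeneousComponent e f) = if edeg u = e then coeff u f else 0 :=
  coeff_homogeneousComponent e f u

/-- The leading monomial of a polynomial is that of its lowest form. -/
theorem isLM_of_isLM_homogeneousComponent {f : MvPolynomial (Fin n) k} {m : Fin n →₀ ℕ} {e : ℕ}
    (h0 : ∀ i < e, homogeneousComponent i f = 0) (h : IsLM (homogeneousComponent e f) m) :
    IsLM f m := by
  rw [isLM_iff] at h ⊢
  obtain ⟨h1, h2⟩ := h
  simp only [coeff_homogeneousComponent', ne_eq, ite_eq_right_iff, Classical.not_imp] at h1 h2
  refine ⟨h1.2, fun u hu => ?_⟩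
  have hue : e ≤ edeg u := by
    by_contra hlt
    have := congrArg (coeff u) (h0 _ (not_le.1 hlt))
    rw [coeff_homogeneousComponent', if_pos rfl] at this
    exact hu this
  rcases hue.eq_or_lt with heq | hlt
  · exact h2 u ⟨heq.symm, hu⟩
  · exact (ndrlGT_iff.1 (Or.inl (by omega))).le

theorem IsLM.initialForm {f : MvPolynomial (Fin n) k} {m : Fin n →₀ ℕ} (h : IsLM f m) :
    IsLM (initialForm f) m := by
  have hm := h.minDeg_eq
  rw [isLM_iff] at h ⊢
  obtain ⟨h1, h2⟩ := h
  rw [AffineSG.initialForm, hm]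
  simp only [coeff_homogeneousComponent', ne_eq, ite_eq_right_iff, Classical.not_imp]
  exact ⟨⟨trivial, h1⟩, fun u hu => h2 u hu.2⟩

/-- The leading monomial of a homogeneous element of `I*` is divisible by that of an element of a
Gröbner basis. -/
theorem IsGroebnerBasis.exists_le_of_mem_starIdeal {I : Ideal (MvPolynomial (Fin n) k)}
    {G : Finset (MvPolynomial (Fin n) k)} (hG : IsGroebnerBasis G I)
    {F : MvPolynomial (Fin n) k} (hF : F ∈ starIdeal I) {e : ℕ} (hFe : F.IsHomogeneous e)
    {m : Fin n →₀ ℕ} (hm : IsLM F m) : ∃ g ∈ G, ∃ mg, IsLM g mg ∧ mg ≤ m := by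
  obtain ⟨f, hf, hfF, hf0⟩ := exists_homogeneousComponent_eq_of_mem_starIdeal hF e
  rw [homogeneousComponent_eq_self (p := F) hFe] at hfF
  have hfm : IsLM f m := isLM_of_isLM_homogeneousComponent hf0 (hfF ▸ hm)
  obtain ⟨g, hg, mg, mf, hgm, hfm', hle⟩ := hG.2 f hf (by
    rintro rfl
    simpa using hfm.1)
  exact ⟨g, hg, mg, hgm, hfm.unique hfm' ▸ hle⟩

end MonomialOrder

section Groebner

variable {n : ℕ} {k : Type} [Field k]

variable (k) in
/-- The ideal generated by the variables preceding `z_j`. -/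
def varIdeal (j : Fin n) : Ideal (MvPolynomial (Fin n) k) :=
  Ideal.span (X '' {i | i < j})

/-- The ideal `I* + (z_i : i < j)`. -/
def stageIdeal (I : Ideal (MvPolynomial (Fin n) k)) (j : Fin n) :
    Ideal (MvPolynomial (Fin n) k) :=
  starIdeal I ⊔ varIdeal k j

theorem isHomogeneousIdeal_stageIdeal (I : Ideal (MvPolynomial (Fin n) k)) (j : Fin n) :
    IsHomogeneousIdeal (stageIdeal I j) :=
  (isHomogeneousIdeal_starIdeal I).sup (isHomogeneousIdeal_span_X _)

theorem coeff_eq_zero_of_mem_varIdeal {j : Fin n} {f : MvPolynomial (Fin n) k}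
    (hf : f ∈ varIdeal k j) {u : Fin n →₀ ℕ} (hu : ∀ i < j, u i = 0) : coeff u f = 0 := by
  by_contra hne
  obtain ⟨i, hi, hui⟩ := mem_ideal_span_X_image.1 hf u (by simpa using hne)
  exact hui (hu i hi)

theorem key_lt_of_apply_ne_zero {u v : Fin n →₀ ℕ} (hd : edeg u = edeg v) {j : Fin n}
    (hu : ∀ i < j, u i = 0) {i : Fin n} (hij : i < j) (hv : v i ≠ 0) : key u < key v := by
  induction i using WellFoundedLT.induction with
  | ind i ih =>
    by_cases h : ∃ i' < i, v i' ≠ 0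
    · obtain ⟨i', hi', hv'⟩ := h
      exact ih i' hi' (hi'.trans hij) hv'
    · push Not at h
      refine ndrlGT_iff.1 (Or.inr ⟨hd, i, ?_, fun l hl => ?_⟩)
      · rw [hu i hij]; omega
      · rw [hu l (hl.trans hij), h l hl]

theorem IsLM.monomial_mul {f : MvPolynomial (Fin n) k} {m : Fin n →₀ ℕ} (h : IsLM f m)
    (a : Fin n →₀ ℕ) : IsLM (monomial a 1 * f) (a + m) := by
  rw [isLM_iff] at h ⊢
  refine ⟨by rw [coeff_monomial_mul, one_mul]; exact h.1, fun u hu => ?_⟩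
  rw [coeff_monomial_mul'] at hu
  split_ifs at hu with hau
  · rw [one_mul] at hu
    obtain ⟨w, rfl⟩ := exists_add_of_le hau
    rw [add_tsub_cancel_left] at hu
    rcases (h.2 w hu).lt_or_eq with h | h
    · exact (key_add_lt_add h a).le
    · rw [key_injective h]
  · exact absurd rfl hu

theorem IsLM.exists_sub {f P : MvPolynomial (Fin n) k} {m : Fin n →₀ ℕ} (hf : IsLM f m)
    (hP : IsLM P m) : ∃ c : k, ∀ m', IsLM (f - C c * P) m' → key m < key m' := by
  rw [isLM_iff] at hf hP
  refine ⟨coeff m f / coeff m P, fun m' hm' => ?_⟩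
  have h := (isLM_iff.1 hm').1
  rw [coeff_sub, coeff_C_mul] at h
  refine lt_of_le_of_ne ?_ fun e => ?_
  · by_cases h0 : coeff m' f = 0
    · exact hP.2 m' fun h1 => h (by rw [h0, h1]; simp)
    · exact hf.2 m' h0
  · rw [← key_injective e, div_mul_cancel₀ _ hP.1, sub_self] at h
    exact h rfl

theorem IsLM.edeg_eq_of_isHomogeneous {f : MvPolynomial (Fin n) k} {m : Fin n →₀ ℕ}
    (h : IsLM f m) {e : ℕ} (hf : f.IsHomogeneous e) : edeg m = e := by
  have := hf (d := m) (by simpa using h.1)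
  rw [edeg_eq_degree, Finsupp.degree_eq_weight_one]
  exact this

theorem IsLM.ne_zero {f : MvPolynomial (Fin n) k} {m : Fin n →₀ ℕ} (h : IsLM f m) : f ≠ 0 := by
  rintro rfl
  simpa using h.1

theorem mem_stageIdeal_of_X_mul_mem_of_isHomogeneous {I : Ideal (MvPolynomial (Fin n) k)}
    {G : Finset (MvPolynomial (Fin n) k)} (hG : IsGroebnerBasis G I) {j : Fin n}
    (hj : ∀ g ∈ G, ∀ m, IsLM g m → m j = 0) {e : ℕ} {f : MvPolynomial (Fin n) k}
    (hf : f.IsHomogeneous e) (hXf : X j * f ∈ stageIdeal I j) : f ∈ stageIdeal I j := by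
  by_contra hfK
  let T : Set (Fin n →₀ ℕ) := {m | ∃ f : MvPolynomial (Fin n) k, f.IsHomogeneous e ∧
    X j * f ∈ stageIdeal I j ∧ f ∉ stageIdeal I j ∧ IsLM f m}
  have hTf : T.Finite := (Finsupp.finite_of_degree_le e).subset (by
    rintro m ⟨f, hf, -, -, hm⟩
    exact (hm.edeg_eq_of_isHomogeneous hf).le)
  have hne : ∀ f : MvPolynomial (Fin n) k, f ∉ stageIdeal I j → f ≠ 0 := by
    rintro _ h rfl
    exact h (zero_mem _)
  obtain ⟨m₀, hm₀⟩ := exists_isLM (hne f hfK)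
  obtain ⟨m, ⟨f, hf, hXf, hfK, hm⟩, hmax⟩ := Set.exists_max_image T key hTf
    ⟨m₀, f, hf, hXf, hfK, hm₀⟩
  have hme := hm.edeg_eq_of_isHomogeneous hf
  obtain ⟨P, hPK, hPe, hP⟩ : ∃ P ∈ stageIdeal I j, P.IsHomogeneous e ∧ IsLM P m := by
    by_cases hmi : ∃ i < j, m i ≠ 0
    · obtain ⟨i, hi, hmi⟩ := hmi
      refine ⟨monomial m 1, Ideal.mem_sup_right (mem_ideal_span_X_image.2 fun u hu => ?_),
        isHomogeneous_monomial _ hme, isLM_iff.2 ⟨by simp, fun u hu => ?_⟩⟩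
      · rw [Finset.mem_singleton.1 (support_monomial_subset hu)]
        exact ⟨i, hi, hmi⟩
      · rw [coeff_monomial, ne_eq, ite_eq_right_iff, Classical.not_imp] at hu
        rw [hu.1]
    · push Not at hmi
      obtain ⟨h, hh, v, hv, hhv⟩ := Submodule.mem_sup.1 hXf
      have hXfe : (X j * f).IsHomogeneous (e + 1) := by
        rw [add_comm]
        exact (isHomogeneous_X k j).mul hf
      have hcoeff : ∀ u, coeff u (homogeneousComponent (e + 1) h) =
          coeff u (X j * f) - coeff u (homogeneousComponent (e + 1) v) := fun u => by
        conv_rhs => rw [← homogeneousComponent_eq_self hXfe, ← hhv, map_add, coeff_add]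
        ring
      have hv' : homogeneousComponent (e + 1) v ∈ varIdeal k j :=
        isHomogeneousIdeal_span_X _ v hv _
      have hXm := hm.monomial_mul (Finsupp.single j 1)
      have hmj : ∀ i < j, (Finsupp.single j 1 + m : Fin n →₀ ℕ) i = 0 := fun i hi => by
        simp [hmi i hi, hi.ne']
      have hLM : IsLM (homogeneousComponent (e + 1) h) (Finsupp.single j 1 + m) := by
        rw [isLM_iff] at hXm ⊢
        constructor
        · rw [hcoeff, coeff_eq_zero_of_mem_varIdeal hv' hmj, sub_zero]
          exact hXm.1
        · intro u hu
          by_cases h0 : coeff u (X j * f) = 0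
          · rw [hcoeff, h0, zero_sub, neg_ne_zero] at hu
            obtain ⟨i, hi, hui⟩ := mem_ideal_span_X_image.1 hv' u (by simpa using hu)
            refine (key_lt_of_apply_ne_zero ?_ hmj hi hui).le
            rw [coeff_homogeneousComponent', ne_eq, ite_eq_right_iff, Classical.not_imp] at hu
            rw [hu.1, edeg_add, hme, edeg_eq_degree, Finsupp.degree_single, add_comm]
          · exact hXm.2 u h0
      obtain ⟨g, hg, mg, hgm, hle⟩ := hG.exists_le_of_mem_starIdeal
        (isHomogeneousIdeal_starIdeal I h hh _) (homogeneousComponent_isHomogeneous _ _) hLM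
      have hmg : mg ≤ m := fun i => by
        by_cases hi : i = j
        · rw [hi, hj g hg mg hgm]; exact Nat.zero_le _
        · simpa [Finsupp.single_apply, Ne.symm hi] using hle i
      refine ⟨monomial (m - mg) 1 * initialForm g, Ideal.mem_sup_left (Ideal.mul_mem_left _ _
        (Ideal.subset_span ⟨g, hG.1 hg, hgm.ne_zero, rfl⟩)), ?_, ?_⟩
      · have : e = edeg (m - mg) + minDeg g := by
          rw [hgm.minDeg_eq, ← edeg_add, tsub_add_cancel_of_le hmg, hme]
        rw [this]
        exact (isHomogeneous_monomial _ rfl).mul (isHomogeneous_initialForm g)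
      · simpa [tsub_add_cancel_of_le hmg] using hgm.initialForm.monomial_mul (m - mg)
  obtain ⟨c, hc⟩ := hm.exists_sub hP
  have hcP : C c * P ∈ stageIdeal I j := Ideal.mul_mem_left _ _ hPK
  have hfP : f - C c * P ∉ stageIdeal I j := fun h => hfK (by simpa using add_mem h hcP)
  obtain ⟨m', hm'⟩ := exists_isLM (hne _ hfP)
  refine (hc m' hm').not_ge (hmax m' ⟨_, ?_, ?_, hfP, hm'⟩)
  · refine hf.sub ?_
    simpa using (isHomogeneous_C (Fin n) c).mul hPe
  · rw [mul_sub]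
    exact sub_mem hXf (Ideal.mul_mem_left _ _ hcP)

theorem mem_stageIdeal_of_X_mul_mem {I : Ideal (MvPolynomial (Fin n) k)}
    {G : Finset (MvPolynomial (Fin n) k)} (hG : IsGroebnerBasis G I) {j : Fin n}
    (hj : ∀ g ∈ G, ∀ m, IsLM g m → m j = 0) {f : MvPolynomial (Fin n) k}
    (hXf : X j * f ∈ stageIdeal I j) : f ∈ stageIdeal I j := by
  rw [← sum_homogeneousComponent f]
  refine sum_mem fun e _ => mem_stageIdeal_of_X_mul_mem_of_isHomogeneous hG hj
    (homogeneousComponent_isHomogeneous e f) ?_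
  rw [← homogeneousComponent_X_mul]
  exact isHomogeneousIdeal_stageIdeal I j _ hXf _

theorem IsMinimalGroebnerBasis.apply_eq_zero {I : Ideal (MvPolynomial (Fin n) k)}
    {G : Finset (MvPolynomial (Fin n) k)} (hG : IsMinimalGroebnerBasis G I) {j : Fin n}
    (hC : ∀ (e : ℕ) (f : MvPolynomial (Fin n) k), f.IsHomogeneous e →
      X j * f ∈ stageIdeal I j → f ∈ stageIdeal I j)
    {g : MvPolynomial (Fin n) k} (hg : g ∈ G) {m : Fin n →₀ ℕ} (hm : IsLM g m)
    (hmi : ∀ i < j, m i = 0) : m j = 0 := by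
  by_contra hmj
  have hm' := isLM_iff.1 hm.initialForm
  obtain ⟨m₁, rfl⟩ : ∃ m₁, m = Finsupp.single j 1 + m₁ :=
    exists_add_of_le (by rw [Finsupp.single_le_iff]; omega)
  have hmin : minDeg g = edeg m₁ + 1 := by
    rw [hm.minDeg_eq, edeg_add, edeg_eq_degree (Finsupp.single j 1), Finsupp.degree_single,
      add_comm]
  have hgI : initialForm g ∈ starIdeal I :=
    Ideal.subset_span ⟨g, hG.1.1 hg, hm.ne_zero, rfl⟩
  have hmem : initialForm g ∈ Ideal.span (X '' (insert j {i | i < j}) :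
      Set (MvPolynomial (Fin n) k)) := by
    refine mem_ideal_span_X_image.2 fun u hu => ?_
    rw [mem_support_iff] at hu
    by_cases h : ∃ i < j, u i ≠ 0
    · obtain ⟨i, hi, hui⟩ := h
      exact ⟨i, Set.mem_insert_of_mem _ hi, hui⟩
    · push Not at h
      refine ⟨j, Set.mem_insert _ _, ?_⟩
      rcases (hm'.2 u hu).lt_or_eq with hlt | heq
      · have hue : edeg u = minDeg g := by
          rw [initialForm, coeff_homogeneousComponent', ne_eq, ite_eq_right_iff,
            Classical.not_imp] at hu
          exact hu.1
        rcases ndrlGT_iff.2 hlt with h' | ⟨-, i, hi, hij⟩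
        · rw [hue, hm.minDeg_eq] at h'
          exact absurd h' (lt_irrefl _)
        · rcases lt_trichotomy i j with hlt | rfl | hlt
          · rw [h i hlt] at hi
            omega
          · omega
          · rw [← hij j hlt]
            exact hmj
      · rw [← key_injective heq]
        exact hmj
  rw [Set.image_insert_eq, Ideal.span_insert, Ideal.mem_span_singleton_sup] at hmem
  obtain ⟨a, b, hb, hab⟩ := hmem
  set h := homogeneousComponent (edeg m₁) a with hh
  have hXh : X j * h = initialForm g - homogeneousComponent (edeg m₁ + 1) b := by
    rw [hh, ← homogeneousComponent_X_mul, mul_comm, eq_sub_iff_add_eq, ← map_add, hab,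
      homogeneousComponent_eq_self]
    rw [← hmin]
    exact isHomogeneous_initialForm g
  have hb' : homogeneousComponent (edeg m₁ + 1) b ∈ varIdeal k j :=
    isHomogeneousIdeal_span_X _ b hb _
  have hhK : h ∈ stageIdeal I j := by
    refine hC _ h (homogeneousComponent_isHomogeneous _ _) ?_
    rw [hXh]
    exact sub_mem (Ideal.mem_sup_left hgI) (Ideal.mem_sup_right hb')
  obtain ⟨F, hF, v, hv, hFv⟩ := Submodule.mem_sup.1 hhK
  have hv' : homogeneousComponent (edeg m₁) v ∈ varIdeal k j :=
    isHomogeneousIdeal_span_X _ v hv _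
  have hcoeff : ∀ u : Fin n →₀ ℕ, (∀ i < j, u i = 0) →
      coeff u (homogeneousComponent (edeg m₁) F) =
        coeff (Finsupp.single j 1 + u) (initialForm g) := fun u hu => by
    have h1 : homogeneousComponent (edeg m₁) F = h - homogeneousComponent (edeg m₁) v := by
      rw [eq_sub_iff_add_eq, ← map_add, hFv, homogeneousComponent_eq_self]
      exact homogeneousComponent_isHomogeneous _ _
    have h2 : coeff u h = coeff (Finsupp.single j 1 + u) (X j * h) := by
      rw [X, coeff_monomial_mul, one_mul]
    rw [h1, coeff_sub, coeff_eq_zero_of_mem_varIdeal hv' hu, sub_zero, h2, hXh, coeff_sub,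
      coeff_eq_zero_of_mem_varIdeal hb' fun i hi => ?_, sub_zero]
    simp [hu i hi, hi.ne']
  have hm₁ : ∀ i < j, m₁ i = 0 := fun i hi => by
    simpa [hi.ne'] using hmi i hi
  have hLM : IsLM (homogeneousComponent (edeg m₁) F) m₁ := by
    refine isLM_iff.2 ⟨by rw [hcoeff _ hm₁]; exact hm'.1, fun u hu => ?_⟩
    by_cases hui : ∃ i < j, u i ≠ 0
    · obtain ⟨i, hi, hui⟩ := hui
      refine (key_lt_of_apply_ne_zero ?_ hm₁ hi hui).le
      rw [coeff_homogeneousComponent', ne_eq, ite_eq_right_iff, Classical.not_imp] at hu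
      exact hu.1.symm
    · push Not at hui
      rw [hcoeff u hui] at hu
      by_contra hlt
      exact (key_add_lt_add (not_le.1 hlt) (Finsupp.single j 1)).not_ge (hm'.2 _ hu)
  obtain ⟨g', hg', mg, hgm, hle⟩ := hG.1.exists_le_of_mem_starIdeal
    (isHomogeneousIdeal_starIdeal I F hF _) (homogeneousComponent_isHomogeneous _ _) hLM
  by_cases hgg : g' = g
  · subst hgg
    rw [hgm.unique hm] at hle
    have := hle j
    simp at this
  · exact hG.2.2 g' hg' g hg hgg _ _ hgm hm (hle.trans le_add_self)

end Groebner

section Weight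

variable {d r : ℕ} {k : Type} [Field k]

namespace SimplicialAffineSemigroup

/-- The element of the semigroup with factorization `u`, as an exponent vector. -/
def expSum (S : SimplicialAffineSemigroup d r) (u : Fin (d + r) →₀ ℕ) : Fin d →₀ ℕ :=
  ∑ i, u i • Finsupp.equivFunOnFinite.symm (S.gen i)

theorem expSum_apply (S : SimplicialAffineSemigroup d r) (u : Fin (d + r) →₀ ℕ) (l : Fin d) :
    S.expSum u l = ∑ i, u i * S.gen i l := by
  simp [expSum, Finsupp.finsetSum_apply]

theorem aeval_monomial_gen (S : SimplicialAffineSemigroup d r) (u : Fin (d + r) →₀ ℕ) (a : k) :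
    aeval (fun i => monomial (Finsupp.equivFunOnFinite.symm (S.gen i)) (1 : k)) (monomial u a) =
      monomial (S.expSum u) a := by
  rw [aeval_monomial, Finsupp.prod_fintype _ _ (by simp), expSum]
  simp only [monomial_pow, one_pow]
  rw [← monomial_sum_one, algebraMap_eq, C_mul_monomial, mul_one]

theorem coeff_aeval_gen (S : SimplicialAffineSemigroup d r) (p : MvPolynomial (Fin (d + r)) k)
    (s : Fin d →₀ ℕ) :
    coeff s (aeval (fun i => monomial (Finsupp.equivFunOnFinite.symm (S.gen i)) (1 : k)) p) =
      ∑ u ∈ p.support, if S.expSum u = s then coeff u p else 0 := by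
  conv_lhs => rw [p.as_sum, map_sum, coeff_sum]
  simp only [aeval_monomial_gen, coeff_monomial]

theorem mem_definingIdeal {S : SimplicialAffineSemigroup d r} {f : MvPolynomial (Fin (d + r)) k} :
    f ∈ S.definingIdeal k ↔
      aeval (fun i => monomial (Finsupp.equivFunOnFinite.symm (S.gen i)) (1 : k)) f = 0 :=
  Iff.rfl

theorem exists_weight (S : SimplicialAffineSemigroup d r) : ∃ y : Fin (d + r) → ℚ,
    (∀ i, y (Fin.castAdd r i) = 1) ∧ (∀ l, 0 ≤ y l) ∧
      ∀ u v, S.expSum u = S.expSum v → ∑ l, (u l : ℚ) * y l = ∑ l, (v l : ℚ) * y l := by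
  let f := Fintype.linearCombination ℚ
    (fun (i : Fin d) (j : Fin d) => ((S.gen (Fin.castAdd r i) j : ℚ)))
  obtain ⟨g, hg⟩ := f.exists_leftInverse_of_injective
    (LinearMap.ker_eq_bot.2 (linearIndependent_iff_injective_fintypeLinearCombination.1 S.li))
  let w : (Fin d → ℚ) →ₗ[ℚ] ℚ := (∑ i, LinearMap.proj i) ∘ₗ g
  have hw : ∀ c : Fin d → ℚ,
      w (∑ j : Fin d, c j • (fun l => (S.gen (Fin.castAdd r j) l : ℚ))) = ∑ j, c j := by
    intro c
    have := LinearMap.congr_fun hg c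
    simp only [LinearMap.comp_apply, f, Fintype.linearCombination_apply, LinearMap.id_apply] at this
    simp only [w, LinearMap.comp_apply, this]
    simp
  refine ⟨fun l => w fun j => (S.gen l j : ℚ), fun i => ?_, fun l => ?_, fun u v huv => ?_⟩
  · have := hw (Pi.single i 1)
    simpa [Pi.single_apply, ite_smul] using this
  · obtain ⟨c, hc, hcl⟩ := S.cone l
    dsimp only
    rw [hcl, hw]
    exact Finset.sum_nonneg fun j _ => hc j
  · have h : ∀ u : Fin (d + r) →₀ ℕ, ∑ l, (u l : ℚ) * w (fun j => (S.gen l j : ℚ)) =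
        w (fun j => (S.expSum u j : ℚ)) := by
      intro u
      have : (fun j => (S.expSum u j : ℚ)) = ∑ l, (u l : ℚ) • fun j => (S.gen l j : ℚ) := by
        ext j
        simp [expSum_apply]
      rw [this, map_sum]
      simp
    rw [h, h, huv]

end SimplicialAffineSemigroup

/-- The polynomials all of whose monomials have weight at least `a`. -/
def weightIdeal {n : ℕ} (k : Type) [Field k] (y : Fin n → ℚ) (hy : ∀ l, 0 ≤ y l) (a : ℚ) :
    Ideal (MvPolynomial (Fin n) k) where
  carrier := {p | ∀ u, coeff u p ≠ 0 → a ≤ ∑ l, (u l : ℚ) * y l}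
  zero_mem' := fun u h => absurd (coeff_zero u) h
  add_mem' := fun {p q} hp hq u hu => by
    by_cases h : coeff u p = 0
    · exact hq u fun h' => hu (by rw [coeff_add, h, h', add_zero])
    · exact hp u h
  smul_mem' := fun p q hq u hu => by
    rw [smul_eq_mul, coeff_mul] at hu
    obtain ⟨⟨v, w⟩, hvw, hne⟩ := Finset.exists_ne_zero_of_sum_ne_zero hu
    replace hvw : v + w = u := Finset.HasAntidiagonal.mem_antidiagonal.1 hvw
    refine (hq w (right_ne_zero_of_mul hne)).trans ?_
    rw [← hvw]
    refine Finset.sum_le_sum fun l _ => mul_le_mul_of_nonneg_right ?_ (hy l)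
    simp

theorem weightIdeal_mul_le {n : ℕ} (y : Fin n → ℚ) (hy : ∀ l, 0 ≤ y l) (a b : ℚ) :
    weightIdeal k y hy a * weightIdeal k y hy b ≤ weightIdeal k y hy (a + b) := by
  refine Ideal.mul_le.2 fun p hp q hq u hu => ?_
  rw [coeff_mul] at hu
  obtain ⟨⟨v, w⟩, hvw, hne⟩ := Finset.exists_ne_zero_of_sum_ne_zero hu
  replace hvw : v + w = u := Finset.HasAntidiagonal.mem_antidiagonal.1 hvw
  refine (add_le_add (hp v (left_ne_zero_of_mul hne)) (hq w (right_ne_zero_of_mul hne))).trans ?_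
  rw [← Finset.sum_add_distrib, ← hvw]
  simp [add_mul]

theorem pow_le_weightIdeal {n : ℕ} (y : Fin n → ℚ) (hy : ∀ l, 0 ≤ y l)
    {J : Ideal (MvPolynomial (Fin n) k)} (hJ : J ≤ weightIdeal k y hy 1) (a : ℕ) :
    J ^ a ≤ weightIdeal k y hy a := by
  induction a with
  | zero =>
    intro p _ u _
    simpa using Finset.sum_nonneg fun l _ => mul_nonneg (Nat.cast_nonneg (u l)) (hy l)
  | succ a ih =>
    rw [pow_succ, Nat.cast_succ]
    exact (Ideal.mul_mono ih hJ).trans (weightIdeal_mul_le y hy _ _)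

theorem pow_add_le_pow_of_mul_pow_eq {R : Type} [CommRing R] {J I : Ideal R} {N : ℕ}
    (h : ∀ n ≥ N, J * I ^ n = I ^ (n + 1)) (n : ℕ) : I ^ (N + n) ≤ J ^ n := by
  have : I ^ (N + n) = J ^ n * I ^ N := by
    induction n with
    | zero => simp
    | succ n ih => rw [← add_assoc, ← h _ (Nat.le_add_right N n), ih, pow_succ', mul_assoc]
  rw [this]
  exact Ideal.mul_le_left

/-- If the extremal rays generate a reduction of the maximal ideal, then all generators lie on or
above the hyperplane spanned by the extremal rays. -/
theorem one_le_weight (S : SimplicialAffineSemigroup d r)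
    (hred : IsReductionIdeal (quotExtremal d r k (S.definingIdeal k))
      (quotMax (S.definingIdeal k)))
    {y : Fin (d + r) → ℚ} (hy1 : ∀ i, y (Fin.castAdd r i) = 1) (hy0 : ∀ l, 0 ≤ y l)
    (hy : ∀ u v, S.expSum u = S.expSum v → ∑ l, (u l : ℚ) * y l = ∑ l, (v l : ℚ) * y l)
    (l : Fin (d + r)) : 1 ≤ y l := by
  obtain ⟨-, N, hN⟩ := hred
  have key : ∀ n : ℕ, (n : ℚ) ≤ (N + n : ℕ) * y l := by
    intro n
    have h1 : Ideal.Quotient.mk (S.definingIdeal k) (X l ^ (N + n)) ∈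
        quotExtremal d r k (S.definingIdeal k) ^ n := by
      refine pow_add_le_pow_of_mul_pow_eq hN n ?_
      rw [map_pow]
      exact Ideal.pow_mem_pow (Ideal.mem_map_of_mem _ (Ideal.subset_span (Set.mem_range_self l))) _
    rw [quotExtremal, ← Ideal.map_pow,
      Ideal.mem_map_iff_of_surjective _ Ideal.Quotient.mk_surjective] at h1
    obtain ⟨p, hp, hpl⟩ := h1
    have hJ : Ideal.span (Set.range fun i : Fin d =>
        (X (Fin.castAdd r i) : MvPolynomial (Fin (d + r)) k)) ≤ weightIdeal k y hy0 1 := by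
      refine Ideal.span_le.2 ?_
      rintro _ ⟨i, rfl⟩ u hu
      rw [coeff_X, ne_eq, ite_eq_right_iff, Classical.not_imp] at hu
      rw [← hu.1]
      simp [Finsupp.single_apply, hy1]
    have hp' := pow_le_weightIdeal y hy0 hJ n hp
    rw [Ideal.Quotient.eq] at hpl
    have hpl' : coeff (S.expSum (Finsupp.single l (N + n))) (aeval (fun i =>
        monomial (Finsupp.equivFunOnFinite.symm (S.gen i)) (1 : k)) p) ≠ 0 := by
      have : aeval (fun i => monomial (Finsupp.equivFunOnFinite.symm (S.gen i)) (1 : k))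
          (p - X l ^ (N + n)) = 0 := hpl
      rw [map_sub, sub_eq_zero] at this
      rw [this, X_pow_eq_monomial, S.aeval_monomial_gen]
      simp
    rw [S.coeff_aeval_gen] at hpl'
    obtain ⟨u, hu, hne⟩ := Finset.exists_ne_zero_of_sum_ne_zero hpl'
    rw [ne_eq, ite_eq_right_iff, Classical.not_imp] at hne
    have h2 := hp' u hne.2
    rw [hy _ _ hne.1] at h2
    rw [Finset.sum_eq_single l (fun b _ hb => by simp [hb.symm]) (by simp)] at h2
    simpa using h2
  by_contra hlt
  push Not at hlt
  obtain ⟨n, hn⟩ := exists_nat_gt (N * y l / (1 - y l))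
  rw [div_lt_iff₀ (by linarith)] at hn
  have := key n
  push_cast at this
  linarith

theorem homogeneousComponent_mem_starIdeal {n : ℕ} {I : Ideal (MvPolynomial (Fin n) k)}
    {f : MvPolynomial (Fin n) k} (hf : f ∈ I) {e : ℕ}
    (h0 : ∀ i < e, homogeneousComponent i f = 0) : homogeneousComponent e f ∈ starIdeal I := by
  by_cases h : homogeneousComponent e f = 0
  · rw [h]
    exact zero_mem _
  · obtain ⟨m, hm⟩ := exists_isLM h
    have hfm := isLM_of_isLM_homogeneousComponent h0 hm
    have he : minDeg f = e := hfm.minDeg_eq.trans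
      (hm.edeg_eq_of_isHomogeneous (homogeneousComponent_isHomogeneous e f))
    exact Ideal.subset_span ⟨f, hf, hfm.ne_zero, by rw [initialForm, he]⟩


namespace SimplicialAffineSemigroup

theorem expSum_mapDomain_apply (S : SimplicialAffineSemigroup d r) (v : Fin d →₀ ℕ) (j : Fin d) :
    S.expSum (v.mapDomain (Fin.castAdd r)) j = ∑ i, v i * S.gen (Fin.castAdd r i) j := by
  rw [expSum_apply, Fin.sum_univ_add]
  have h : ∀ i : Fin r, v.mapDomain (Fin.castAdd r) (Fin.natAdd d i) = 0 := fun i =>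
    Finsupp.mapDomain_of_notMem_range _ _ (by
      rintro ⟨i', hi'⟩
      have h1 := congrArg Fin.val hi'
      simp only [Fin.val_castAdd, Fin.val_natAdd] at h1
      omega)
  simp [h, Finsupp.mapDomain_apply (Fin.castAdd_injective d r)]

theorem expSum_mapDomain_injective (S : SimplicialAffineSemigroup d r) :
    Function.Injective fun v : Fin d →₀ ℕ => S.expSum (v.mapDomain (Fin.castAdd r)) := by
  intro v w h
  have h' := linearIndependent_iff_injective_fintypeLinearCombination.1 S.li
    (a₁ := fun i => (v i : ℚ)) (a₂ := fun i => (w i : ℚ)) (by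
      ext j
      have := DFunLike.congr_fun h j
      simp only [expSum_mapDomain_apply] at this
      simpa [Fintype.linearCombination_apply] using (mod_cast this :
        ∑ i, (v i : ℚ) * S.gen (Fin.castAdd r i) j = ∑ i, (w i : ℚ) * S.gen (Fin.castAdd r i) j))
  ext i
  exact_mod_cast congrFun h' i

theorem exists_expSum_single_eq (S : SimplicialAffineSemigroup d r) (l : Fin (d + r)) :
    ∃ q ≠ 0, ∃ c : Fin d →₀ ℕ,
      S.expSum (Finsupp.single l q) = S.expSum (c.mapDomain (Fin.castAdd r)) := by
  obtain ⟨c, hc, hcl⟩ := S.cone l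
  have h : ∀ j, ∃ e : ℕ, (e : ℚ) = (∏ i, (c i).den : ℕ) * c j := by
    intro j
    obtain ⟨m, hm⟩ := Finset.dvd_prod_of_mem (fun i => (c i).den) (Finset.mem_univ j)
    refine ⟨m * (c j).num.toNat, ?_⟩
    have h1 : (((c j).num.toNat : ℤ) : ℚ) = (c j).num := by
      rw [Int.toNat_of_nonneg (Rat.num_nonneg.2 (hc j))]
    rw [hm, Nat.cast_mul, Nat.cast_mul, ← Int.cast_natCast (c j).num.toNat, h1,
      mul_comm ((c j).den : ℚ), mul_assoc, Rat.den_mul_eq_num]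
  choose e he using h
  refine ⟨∏ i, (c i).den, Finset.prod_ne_zero_iff.2 fun i _ => (c i).den_ne_zero,
    Finsupp.equivFunOnFinite.symm e, ?_⟩
  ext j
  rw [expSum_mapDomain_apply, expSum_apply,
    Finset.sum_eq_single l (fun b _ hb => by simp [hb.symm]) (by simp)]
  have := congrFun hcl j
  rw [← Nat.cast_inj (R := ℚ)]
  push_cast at he ⊢
  simp only [Finsupp.single_eq_same, Finsupp.equivFunOnFinite_symm_apply_apply, he]
  push_cast
  rw [this, Finset.sum_apply, Finset.mul_sum]
  exact Finset.sum_congr rfl fun i _ => by simp [mul_assoc]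

end SimplicialAffineSemigroup

theorem sum_mapDomain_castAdd {y : Fin (d + r) → ℚ} (hy1 : ∀ i, y (Fin.castAdd r i) = 1)
    (v : Fin d →₀ ℕ) :
    ∑ l, (v.mapDomain (Fin.castAdd r) l : ℚ) * y l = edeg (v.mapDomain (Fin.castAdd r)) := by
  rw [edeg_eq_degree, Finsupp.degree_eq_sum, Nat.cast_sum]
  refine Finset.sum_congr rfl fun l _ => ?_
  by_cases hl : l ∈ Set.range (Fin.castAdd r : Fin d → Fin (d + r))
  · obtain ⟨i, rfl⟩ := hl
    rw [hy1, mul_one]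
  · simp [Finsupp.mapDomain_of_notMem_range _ _ hl]

/-- Some power of each variable is congruent modulo `I*` to a polynomial without constant term in
the first `d` variables. -/
theorem exists_pow_sub_rename_mem_starIdeal (S : SimplicialAffineSemigroup d r)
    (hred : IsReductionIdeal (quotExtremal d r k (S.definingIdeal k))
      (quotMax (S.definingIdeal k))) (l : Fin (d + r)) :
    ∃ q ≠ 0, ∃ p : MvPolynomial (Fin d) k, constantCoeff p = 0 ∧
      X l ^ q - rename (Fin.castAdd r) p ∈ starIdeal (S.definingIdeal k) := by
  obtain ⟨y, hy1, hy0, hy⟩ := S.exists_weight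
  have hyl := one_le_weight S hred hy1 hy0 hy l
  obtain ⟨q, hq, c, hqc⟩ := S.exists_expSum_single_eq l
  have hle : q ≤ edeg (c.mapDomain (Fin.castAdd r)) := by
    have := hy _ _ hqc
    rw [sum_mapDomain_castAdd hy1,
      Finset.sum_eq_single l (fun b _ hb => by simp [hb.symm]) (by simp)] at this
    simp only [Finsupp.single_eq_same] at this
    have h2 : (q : ℚ) ≤ q * y l := le_mul_of_one_le_right (Nat.cast_nonneg q) hyl
    rw [this] at h2
    exact_mod_cast h2
  set f : MvPolynomial (Fin (d + r)) k :=
    X l ^ q - monomial (c.mapDomain (Fin.castAdd r)) 1 with hf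
  have hfI : f ∈ S.definingIdeal k := by
    rw [SimplicialAffineSemigroup.mem_definingIdeal, hf, map_sub, X_pow_eq_monomial, S.aeval_monomial_gen,
      S.aeval_monomial_gen, hqc, sub_self]
  have hcomp : ∀ i, homogeneousComponent i f = (if q = i then X l ^ q else 0) -
      if edeg (c.mapDomain (Fin.castAdd r)) = i then
        monomial (c.mapDomain (Fin.castAdd r)) 1 else 0 := by
    intro i
    rw [hf, map_sub, homogeneousComponent_of_mem (n := q) (isHomogeneous_X_pow l q),
      homogeneousComponent_of_mem (n := edeg (c.mapDomain (Fin.castAdd r)))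
        (isHomogeneous_monomial _ rfl)]
    simp only [eq_comm]
  have h0 : ∀ i < q, homogeneousComponent i f = 0 := fun i hi => by
    rw [hcomp, if_neg (by omega), if_neg (by omega), sub_zero]
  have hmem := homogeneousComponent_mem_starIdeal hfI h0
  rw [hcomp, if_pos rfl] at hmem
  refine ⟨q, hq, if edeg (c.mapDomain (Fin.castAdd r)) = q then monomial c 1 else 0, ?_, ?_⟩
  · split_ifs with h
    · rw [constantCoeff_monomial, if_neg]
      rintro rfl
      rw [Finsupp.mapDomain_zero] at h
      exact hq h.symm
    · simp
  · split_ifs at hmem ⊢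
    · rwa [rename_monomial]
    · rwa [map_zero]

/-- The first `d` variables are algebraically independent modulo `I*`. -/
theorem eq_zero_of_rename_mem_starIdeal (S : SimplicialAffineSemigroup d r)
    (hred : IsReductionIdeal (quotExtremal d r k (S.definingIdeal k))
      (quotMax (S.definingIdeal k))) {p : MvPolynomial (Fin d) k}
    (hp : rename (Fin.castAdd r) p ∈ starIdeal (S.definingIdeal k)) : p = 0 := by
  obtain ⟨y, hy1, hy0, hy⟩ := S.exists_weight
  have hyl := one_le_weight S hred hy1 hy0 hy
  ext u
  by_contra hu
  rw [coeff_zero] at hu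
  set U := u.mapDomain (Fin.castAdd r) with hU
  obtain ⟨f, hf, hfe, hf0⟩ := exists_homogeneousComponent_eq_of_mem_starIdeal hp (edeg U)
  have hcoeff : ∀ v, edeg v = edeg U → coeff v f = coeff v (rename (Fin.castAdd r) p) := by
    intro v hv
    have := congrArg (coeff v) hfe
    simpa only [coeff_homogeneousComponent', if_pos hv] using this
  have h0 : coeff (S.expSum U) (aeval (fun i => monomial
      (Finsupp.equivFunOnFinite.symm (S.gen i)) (1 : k)) f) = 0 := by
    rw [SimplicialAffineSemigroup.mem_definingIdeal.1 hf, coeff_zero]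
  have hUp : coeff U f = coeff u p := by
    rw [hcoeff U rfl, hU, coeff_rename_mapDomain _ (Fin.castAdd_injective d r)]
  rw [S.coeff_aeval_gen, Finset.sum_eq_single U, if_pos rfl, hUp] at h0
  · exact hu h0
  · intro v hv hvU
    rw [ite_eq_right_iff]
    intro hvs
    exfalso
    rw [mem_support_iff] at hv
    have h1 : edeg U ≤ edeg v := by
      by_contra hlt
      have := congrArg (coeff v) (hf0 _ (not_le.1 hlt))
      rw [coeff_homogeneousComponent', if_pos rfl] at this
      exact hv this
    have h2 : (edeg v : ℚ) ≤ edeg U := by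
      rw [← sum_mapDomain_castAdd hy1, ← hy _ _ hvs, edeg_eq_degree, Finsupp.degree_eq_sum,
        Nat.cast_sum]
      exact Finset.sum_le_sum fun l _ => le_mul_of_one_le_right (Nat.cast_nonneg _) (hyl l)
    rw [hcoeff v (le_antisymm (mod_cast h2) h1)] at hv
    obtain ⟨w, rfl, -⟩ := coeff_rename_ne_zero _ _ _ hv
    exact hvU (congrArg _ (S.expSum_mapDomain_injective hvs))
  · intro hU'
    rw [if_pos rfl]
    simpa using hU'

/-- The associated graded ring has dimension `d`. -/
theorem ringKrullDim_quotient_starIdeal (S : SimplicialAffineSemigroup d r)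
    (hred : IsReductionIdeal (quotExtremal d r k (S.definingIdeal k))
      (quotMax (S.definingIdeal k))) :
    ringKrullDim (MvPolynomial (Fin (d + r)) k ⧸ starIdeal (S.definingIdeal k)) = d := by
  let ψ : MvPolynomial (Fin d) k →+* MvPolynomial (Fin (d + r)) k ⧸ starIdeal (S.definingIdeal k) :=
    (Ideal.Quotient.mk _).comp (rename (Fin.castAdd r)).toRingHom
  algebraize [ψ]
  have hinj : Function.Injective (algebraMap (MvPolynomial (Fin d) k)
      (MvPolynomial (Fin (d + r)) k ⧸ starIdeal (S.definingIdeal k))) :=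
    (injective_iff_map_eq_zero _).2 fun p hp => eq_zero_of_rename_mem_starIdeal S hred
      (Ideal.Quotient.eq_zero_iff_mem.1 hp)
  have hintegral : Algebra.IsIntegral (MvPolynomial (Fin d) k)
      (MvPolynomial (Fin (d + r)) k ⧸ starIdeal (S.definingIdeal k)) := by
    refine ⟨fun b => ?_⟩
    obtain ⟨f, rfl⟩ := Ideal.Quotient.mk_surjective b
    induction f using MvPolynomial.induction_on with
    | C a =>
      have : Ideal.Quotient.mk (starIdeal (S.definingIdeal k)) (C a) =
          algebraMap (MvPolynomial (Fin d) k) _ (C a) := by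
        rw [RingHom.algebraMap_toAlgebra]
        simp [ψ]
      rw [this]
      exact isIntegral_algebraMap
    | add p q hp hq => rw [map_add]; exact hp.add hq
    | mul_X p l hp =>
      rw [map_mul]
      refine hp.mul ?_
      obtain ⟨q, hq, f, -, hf⟩ := exists_pow_sub_rename_mem_starIdeal S hred l
      refine IsIntegral.of_pow (Nat.pos_of_ne_zero hq) ?_
      rw [← map_pow, Ideal.Quotient.eq.2 hf]
      exact isIntegral_algebraMap (x := f)
  rw [ringKrullDim_eq_of_isIntegral_of_injective hinj,
    MvPolynomial.ringKrullDim_of_isNoetherianRing,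
    ringKrullDim_eq_zero_of_field]
  simp

end Weight

section Quotient

variable {n : ℕ} {k : Type} [Field k]

theorem mem_span_range_X_iff {f : MvPolynomial (Fin n) k} :
    f ∈ Ideal.span (Set.range (X : Fin n → MvPolynomial (Fin n) k)) ↔ constantCoeff f = 0 := by
  rw [← Set.image_univ, mem_ideal_span_X_image, constantCoeff_eq]
  constructor
  · intro h
    by_contra h0
    obtain ⟨i, -, hi⟩ := h 0 (mem_support_iff.2 h0)
    exact hi rfl
  · intro h m hm
    by_contra! h'
    have : m = 0 := Finsupp.ext fun i => h' i (Set.mem_univ i)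
    exact mem_support_iff.1 hm (this ▸ h)

theorem constantCoeff_eq_zero_of_mem_starIdeal {I : Ideal (MvPolynomial (Fin n) k)}
    (hI : ∀ f ∈ I, constantCoeff f = 0) {f : MvPolynomial (Fin n) k} (hf : f ∈ starIdeal I) :
    constantCoeff f = 0 := by
  suffices starIdeal I ≤ RingHom.ker (constantCoeff : MvPolynomial (Fin n) k →+* k) from this hf
  refine Ideal.span_le.2 ?_
  rintro _ ⟨f, hf, -, rfl⟩
  rw [SetLike.mem_coe, RingHom.mem_ker, constantCoeff_eq, initialForm,
    coeff_homogeneousComponent]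
  split_ifs
  · exact hI f hf
  · rfl

theorem mk_mem_quotMax_iff {J : Ideal (MvPolynomial (Fin n) k)}
    (hJ : ∀ f ∈ J, constantCoeff f = 0) {f : MvPolynomial (Fin n) k} :
    Ideal.Quotient.mk J f ∈ quotMax J ↔ constantCoeff f = 0 := by
  rw [quotMax, Ideal.mem_quotient_iff_mem_sup, sup_eq_left.2, mem_span_range_X_iff]
  exact fun g hg => mem_span_range_X_iff.2 (hJ g hg)

theorem isPrime_quotMax {J : Ideal (MvPolynomial (Fin n) k)}
    (hJ : ∀ f ∈ J, constantCoeff f = 0) : (quotMax J).IsPrime := by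
  have : quotMax J = RingHom.ker (Ideal.Quotient.lift J constantCoeff hJ) := by
    ext x
    obtain ⟨f, rfl⟩ := Ideal.Quotient.mk_surjective x
    rw [mk_mem_quotMax_iff hJ, RingHom.mem_ker, Ideal.Quotient.lift_mk]
  rw [this]
  exact RingHom.ker_isPrime _

theorem IsHomogeneousIdeal.mem_of_mul_mem {J : Ideal (MvPolynomial (Fin n) k)}
    (hJ : IsHomogeneousIdeal J) {s f : MvPolynomial (Fin n) k} {e : ℕ} (hf : f.IsHomogeneous e)
    (hs : constantCoeff s ≠ 0) (h : s * f ∈ J) : f ∈ J := by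
  have := hJ _ h e
  rw [homogeneousComponent_mul_of_isHomogeneous hf, if_pos le_rfl, Nat.sub_self,
    homogeneousComponent_zero] at this
  have h2 := J.mul_mem_left (C (constantCoeff s)⁻¹) this
  rwa [← mul_assoc, ← constantCoeff_eq, ← C_mul, inv_mul_cancel₀ hs, C_1, one_mul] at h2

end Quotient

section Extremal

variable {d r : ℕ} {k : Type} [Field k]

theorem SimplicialAffineSemigroup.constantCoeff_eq_zero (S : SimplicialAffineSemigroup d r)
    {f : MvPolynomial (Fin (d + r)) k} (hf : f ∈ S.definingIdeal k) : constantCoeff f = 0 := by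
  rw [mem_definingIdeal] at hf
  have h : (constantCoeff : MvPolynomial (Fin d) k →+* k).comp
      (aeval (fun i => monomial (Finsupp.equivFunOnFinite.symm (S.gen i)) (1 : k)) :
        MvPolynomial (Fin (d + r)) k →ₐ[k] MvPolynomial (Fin d) k).toRingHom = constantCoeff := by
    ext i
    · simp
    · have : Finsupp.equivFunOnFinite.symm (S.gen i) ≠ 0 := fun h0 => S.gen_ne_zero i <| by
        rw [← Finsupp.equivFunOnFinite.apply_symm_apply (S.gen i), h0]
        rfl
      simp [constantCoeff_monomial, this]
  rw [← h]
  exact (congrArg constantCoeff hf).trans (map_zero _)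

/-- The image of the variable `z_i` of an extremal ray in `A/I*`. -/
def extremalVar (I : Ideal (MvPolynomial (Fin (d + r)) k)) (i : Fin d) :
    MvPolynomial (Fin (d + r)) k ⧸ starIdeal I :=
  Ideal.Quotient.mk _ (X (Fin.castAdd r i))

theorem span_extremalVar (I : Ideal (MvPolynomial (Fin (d + r)) k)) (i : Fin d) :
    Ideal.span (extremalVar I '' {i' | i' < i}) =
      (varIdeal k (Fin.castAdd r i)).map (Ideal.Quotient.mk (starIdeal I)) := by
  rw [varIdeal, Ideal.map_span, Set.image_image]
  congr 1
  ext x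
  constructor
  · rintro ⟨l, hl, rfl⟩
    exact ⟨Fin.castAdd r l, hl, rfl⟩
  · rintro ⟨l, hl, rfl⟩
    exact ⟨⟨l, lt_trans hl i.2⟩, hl, rfl⟩

theorem mk_mem_span_extremalVar {I : Ideal (MvPolynomial (Fin (d + r)) k)} {i : Fin d}
    {f : MvPolynomial (Fin (d + r)) k} :
    Ideal.Quotient.mk (starIdeal I) f ∈ Ideal.span (extremalVar I '' {i' | i' < i}) ↔
      f ∈ stageIdeal I (Fin.castAdd r i) := by
  rw [span_extremalVar, Ideal.mem_quotient_iff_mem_sup, sup_comm, stageIdeal]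

theorem isCM_of_isGroebnerBasis (S : SimplicialAffineSemigroup d r)
    (hred : IsReductionIdeal (quotExtremal d r k (S.definingIdeal k))
      (quotMax (S.definingIdeal k)))
    {G : Finset (MvPolynomial (Fin (d + r)) k)} (hG : IsGroebnerBasis G (S.definingIdeal k))
    (h : ∀ g ∈ G, ∀ m, IsLM g m → ∀ j : Fin (d + r), (j : ℕ) < d → m j = 0) :
    IsCM (MvPolynomial (Fin (d + r)) k ⧸ starIdeal (S.definingIdeal k))
      (quotMax (starIdeal (S.definingIdeal k))) := by
  have hJ : ∀ f ∈ starIdeal (S.definingIdeal k), constantCoeff f = 0 := fun f =>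
    constantCoeff_eq_zero_of_mem_starIdeal fun f => S.constantCoeff_eq_zero
  have hmem : ∀ x ∈ List.ofFn (extremalVar (S.definingIdeal k)),
      x ∈ quotMax (starIdeal (S.definingIdeal k)) := by
    intro x hx
    obtain ⟨i, rfl⟩ := List.mem_ofFn.1 hx
    exact (mk_mem_quotMax_iff hJ).2 (constantCoeff_X k _)
  refine ⟨List.ofFn (extremalVar (S.definingIdeal k)), hmem, ⟨?_, ?_⟩, ?_⟩
  · refine (isWeaklyRegular_ofFn_iff _).2 fun i x hx => ?_
    obtain ⟨f, rfl⟩ := Ideal.Quotient.mk_surjective x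
    rw [extremalVar, ← map_mul, mk_mem_span_extremalVar] at hx
    exact mk_mem_span_extremalVar.2
      (mem_stageIdeal_of_X_mul_mem hG (fun g hg m hm => h g hg m hm _ i.2) hx)
  · rw [smul_eq_mul, Ideal.mul_top]
    refine fun htop => (isPrime_quotMax hJ).ne_top (top_le_iff.1 ?_)
    rw [htop]
    exact Ideal.span_le.2 hmem
  · rw [ringKrullDim_quotient_starIdeal S hred, List.length_ofFn]

theorem mem_stageIdeal_of_isCM (S : SimplicialAffineSemigroup d r)
    (hred : IsReductionIdeal (quotExtremal d r k (S.definingIdeal k))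
      (quotMax (S.definingIdeal k)))
    (hCM : IsCM (MvPolynomial (Fin (d + r)) k ⧸ starIdeal (S.definingIdeal k))
      (quotMax (starIdeal (S.definingIdeal k)))) (i : Fin d) (e : ℕ)
    (f : MvPolynomial (Fin (d + r)) k) (hf : f.IsHomogeneous e)
    (hXf : X (Fin.castAdd r i) * f ∈ stageIdeal (S.definingIdeal k) (Fin.castAdd r i)) :
    f ∈ stageIdeal (S.definingIdeal k) (Fin.castAdd r i) := by
  have hJ : ∀ f ∈ starIdeal (S.definingIdeal k), constantCoeff f = 0 := fun f =>
    constantCoeff_eq_zero_of_mem_starIdeal fun f => S.constantCoeff_eq_zero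
  set I := S.definingIdeal k
  have hp := isPrime_quotMax hJ
  obtain ⟨ys, hys, hreg, hlen⟩ := hCM
  rw [ringKrullDim_quotient_starIdeal S hred] at hlen
  let R := Localization.AtPrime (quotMax (starIdeal I))
  let φ := algebraMap (MvPolynomial (Fin (d + r)) k ⧸ starIdeal I) R
  have : IsNoetherianRing R := IsLocalization.isNoetherianRing (quotMax (starIdeal I)).primeCompl R
    inferInstance
  have hregR : RingTheory.Sequence.IsRegular R (ys.map φ) :=
    hreg.toIsWeaklyRegular.isRegular_of_isLocalization_of_mem R (quotMax (starIdeal I)) hys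
  have hmax : ∀ x, φ x ∈ IsLocalRing.maximalIdeal R ↔ x ∈ quotMax (starIdeal I) := fun x =>
    IsLocalization.AtPrime.to_map_mem_maximal_iff R (quotMax (starIdeal I)) x
  have hweak : RingTheory.Sequence.IsWeaklyRegular R (List.ofFn (φ ∘ extremalVar I)) := by
    refine isWeaklyRegular_of_support_eq_closedPoint _ ?_ ?_ (ys := ys.map φ) ?_ hregR ?_
    · intro z hz
      obtain ⟨l, rfl⟩ := List.mem_ofFn.1 hz
      exact (hmax _).2 ((mk_mem_quotMax_iff hJ).2 (constantCoeff_X k _))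
    · intro q hq _ hzq
      refine le_antisymm (IsLocalRing.le_maximalIdeal hq.ne_top) ?_
      rw [← IsLocalization.AtPrime.map_eq_maximalIdeal (quotMax (starIdeal I)) R,
        Ideal.map_le_iff_le_comap]
      refine Ideal.map_le_iff_le_comap.2 (Ideal.span_le.2 ?_)
      rintro _ ⟨l, rfl⟩
      obtain ⟨N, hN, p, hp0, hmem⟩ := exists_pow_sub_rename_mem_starIdeal S hred l
      have hpq : φ (Ideal.Quotient.mk _ (rename (Fin.castAdd r) p)) ∈ q := by
        have hle : Ideal.span (Set.range (X : Fin d → MvPolynomial (Fin d) k)) ≤ q.comap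
            ((φ.comp (Ideal.Quotient.mk _)).comp (rename (Fin.castAdd r)).toRingHom) := by
          refine Ideal.span_le.2 ?_
          rintro _ ⟨l, rfl⟩
          simpa [Ideal.mem_comap, extremalVar] using hzq _ (List.mem_ofFn.2 ⟨l, rfl⟩)
        exact hle (mem_span_range_X_iff.2 hp0)
      refine hq.mem_of_pow_mem N ?_
      rw [← Ideal.Quotient.eq] at hmem
      rwa [← hmem, map_pow, map_pow] at hpq
    · intro y hy
      obtain ⟨x, hx, rfl⟩ := List.mem_map.1 hy
      exact (hmax x).2 (hys x hx)
    · rw [List.length_map, List.length_ofFn]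
      exact_mod_cast hlen.symm
  have hspan : Ideal.span ((φ ∘ extremalVar I) '' {i' | i' < i}) =
      (Ideal.span (extremalVar I '' {i' | i' < i})).map φ := by
    rw [Ideal.map_span, Set.image_image]
    rfl
  have hloc := (isWeaklyRegular_ofFn_iff _).1 hweak i (φ (Ideal.Quotient.mk _ f))
  rw [hspan] at hloc
  have hin : φ (Ideal.Quotient.mk _ f) ∈
      (Ideal.span (extremalVar I '' {i' | i' < i})).map φ := by
    refine hloc ?_
    rw [Function.comp_apply, ← map_mul]
    refine Ideal.mem_map_of_mem φ ?_
    rw [extremalVar, ← map_mul]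
    exact mk_mem_span_extremalVar.2 hXf
  obtain ⟨s, hs, hsf⟩ := (IsLocalization.algebraMap_mem_map_algebraMap_iff
    (quotMax (starIdeal I)).primeCompl R _ _).1 hin
  obtain ⟨s, rfl⟩ := Ideal.Quotient.mk_surjective s
  rw [← map_mul, mk_mem_span_extremalVar] at hsf
  exact (isHomogeneousIdeal_stageIdeal I _).mem_of_mul_mem hf
    (fun h0 => hs ((mk_mem_quotMax_iff hJ).2 h0)) hsf

end Extremal

end AffineSG

open AffineSG MvPolynomial in
/-- Gröbner basis criterion for the Cohen–Macaulayness of the associated graded ring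
`gr_𝔪(k[S]) ≅ A/I(S)*`: assuming `k[S]` is Cohen–Macaulay and the extremal-ray ideal
`(x^{a_1},…,x^{a_d})` is a reduction of `𝔪`, the ring `gr_𝔪(k[S])` is Cohen–Macaulay iff no
variable `z_j` with `1 ≤ j ≤ d` divides the leading monomial of an element of a minimal
Gröbner basis of `I(S)` (negative degree reverse lexicographic order, `z_{d+r} > ⋯ > z_1`). -/
theorem assocGraded_CM_iff_groebner {d r : ℕ} {k : Type} [Field k]
    (S : SimplicialAffineSemigroup d r)
    (hCM : IsCM (MvPolynomial (Fin (d + r)) k ⧸ S.definingIdeal k)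
      (quotMax (S.definingIdeal k)))
    (hred : IsReductionIdeal (quotExtremal d r k (S.definingIdeal k))
      (quotMax (S.definingIdeal k)))
    (G : Finset (MvPolynomial (Fin (d + r)) k))
    (hG : IsMinimalGroebnerBasis G (S.definingIdeal k)) :
    IsCM (MvPolynomial (Fin (d + r)) k ⧸ starIdeal (S.definingIdeal k))
        (quotMax (starIdeal (S.definingIdeal k))) ↔
      ∀ g ∈ G, ∀ m, IsLM g m → ∀ j : Fin (d + r), (j : ℕ) < d → m j = 0 := by
  refine ⟨fun h g hg m hm j => ?_, isCM_of_isGroebnerBasis S hred hG.1⟩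
  induction j using WellFoundedLT.induction with
  | ind j ih =>
    intro hj
    exact hG.apply_eq_zero (mem_stageIdeal_of_isCM S hred h ⟨j, hj⟩) hg hm
      fun i hi => ih i hi (lt_trans hi hj)
end
end

section
/- If S is a simplicial affine semigroup of homogeneous type (i.e., β_i(k[S]) = β_i(gr_𝔪(k[S])) for all i ≥ 1) and k[S] is Cohen–Macaulay, then depth(gr_𝔪(k[S])) = depth(k[S]) = dim(k[S]) = dim(gr_𝔪(k[S])); in particular gr_𝔪(k[S]) is Cohen–Macaulay. -/
open MvPolynomial CategoryTheory

set_option maxHeartbeats 1000000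
set_option synthInstance.maxHeartbeats 400000

noncomputable section

namespace TorAux
open MonoidalCategory TensorProduct
variable {A : Type} [CommRing A]

/-- The complex `X ⊗ P` for a projective resolution `P` of `M`. -/
abbrev tensorComplex (M X : ModuleCat.{0} A) : ChainComplex (ModuleCat.{0} A) ℕ :=
  (((tensoringLeft _).obj X).mapHomologicalComplex (ComplexShape.down ℕ)).obj
    (projectiveResolution M).complex

/-- The map `X ⊗ P ⟶ Y ⊗ P` induced by `X ⟶ Y`. -/
def tensorComplexMap (M : ModuleCat.{0} A) {X Y : ModuleCat.{0} A} (f : X ⟶ Y) :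
    tensorComplex M X ⟶ tensorComplex M Y :=
  (NatTrans.mapHomologicalComplex ((tensoringLeft _).map f) _).app
    (projectiveResolution M).complex

lemma tensorComplexMap_comp (M : ModuleCat.{0} A) {X Y Z : ModuleCat.{0} A} (f : X ⟶ Y)
    (g : Y ⟶ Z) : tensorComplexMap M (f ≫ g) = tensorComplexMap M f ≫ tensorComplexMap M g := by
  simp only [tensorComplexMap, Functor.map_comp]
  rfl

lemma tensorComplexMap_f (M : ModuleCat.{0} A) {X Y : ModuleCat.{0} A} (f : X ⟶ Y) (i : ℕ) :
    (tensorComplexMap M f).f i = f ▷ (projectiveResolution M).complex.X i := rfl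

lemma tensorComplexMap_zero (M X Y : ModuleCat.{0} A) :
    tensorComplexMap M (0 : X ⟶ Y) = 0 := by
  ext i : 1
  rw [tensorComplexMap_f]
  simp
  rfl

lemma tensorComplexMap_smul (M X : ModuleCat.{0} A) (a : A) :
    tensorComplexMap M (a • 𝟙 X) = a • 𝟙 _ := by
  ext i : 1
  rw [tensorComplexMap_f, HomologicalComplex.smul_f_apply]
  simp
  rfl

instance (M : ModuleCat.{0} A) (i : ℕ) : Module.Flat A ((projectiveResolution M).complex.X i) := by
  have : Module.Projective A ((projectiveResolution M).complex.X i) := by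
    rw [IsProjective.iff_projective]
    exact (projectiveResolution M).projective i
  infer_instance

/-- The short exact sequence of complexes induced by a short exact sequence of modules. -/
lemma tensorComplex_shortExact (M : ModuleCat.{0} A) {S : ShortComplex (ModuleCat.{0} A)}
    (hS : S.ShortExact) :
    (ShortComplex.mk (tensorComplexMap M S.f) (tensorComplexMap M S.g)
      (by rw [← tensorComplexMap_comp, S.zero, tensorComplexMap_zero])).ShortExact := by
  apply HomologicalComplex.shortExact_of_degreewise_shortExact
  intro i
  have h := Module.Flat.rTensor_shortComplex_exact ((projectiveResolution M).complex.X i) S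
    hS.exact
  refine { exact := h, mono_f := ?_, epi_g := ?_ }
  · have := (ModuleCat.mono_iff_injective _).1 hS.mono_f
    rw [ModuleCat.mono_iff_injective]
    exact Module.Flat.rTensor_preserves_injective_linearMap S.f.hom this
  · have := (ModuleCat.epi_iff_surjective _).1 hS.epi_g
    rw [ModuleCat.epi_iff_surjective]
    exact LinearMap.rTensor_surjective _ this


lemma homologyMap_smul_id (K : ChainComplex (ModuleCat.{0} A) ℕ) (a : A) (i : ℕ) :
    HomologicalComplex.homologyMap (a • 𝟙 K) i = a • 𝟙 (K.homology i) := by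
  have h : (HomologicalComplex.shortComplexFunctor (ModuleCat.{0} A) _ i).map (a • 𝟙 K) =
      a • 𝟙 (K.sc i) := rfl
  rw [HomologicalComplex.homologyMap, h, ShortComplex.homologyMap_smul,
    ShortComplex.homologyMap_id]
  rfl

variable (A) (M : Type) [AddCommGroup M] [Module A M]

/-- `Tor i X M`, computed from a projective resolution of `M`. -/
abbrev TorMod (i : ℕ) (X : Type) [AddCommGroup X] [Module A X] : ModuleCat.{0} A :=
  (tensorComplex (ModuleCat.of A M) (ModuleCat.of A X)).homology i

variable {A}
variable {X Y Z : Type} [AddCommGroup X] [Module A X] [AddCommGroup Y] [Module A Y]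
  [AddCommGroup Z] [Module A Z]

/-- Functoriality of `TorMod` in the first tensor factor. -/
def torMap (i : ℕ) (f : X →ₗ[A] Y) : TorMod A M i X →ₗ[A] TorMod A M i Y :=
  (HomologicalComplex.homologyMap
    (tensorComplexMap (ModuleCat.of A M) (ModuleCat.ofHom f)) i).hom

lemma torMap_smul (i : ℕ) (a : A) (t : TorMod A M i X) :
    torMap M i (LinearMap.lsmul A X a) t = a • t := by
  have h : ModuleCat.ofHom (LinearMap.lsmul A X a) = a • 𝟙 (ModuleCat.of A X) := rfl
  rw [torMap, h, tensorComplexMap_smul, homologyMap_smul_id]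
  rfl

lemma torMap_exact (f : X →ₗ[A] Y) (g : Y →ₗ[A] Z) (hf : Function.Injective f)
    (hg : Function.Surjective g) (hfg : Function.Exact f g) (i : ℕ) :
    ∃ δ : TorMod A M (i + 1) Z →ₗ[A] TorMod A M i X,
      Function.Exact (torMap M (i + 1) g) δ ∧ Function.Exact δ (torMap M i f) ∧
      Function.Exact (torMap M i f) (torMap M i g) := by
  let S : ShortComplex (ModuleCat.{0} A) := ShortComplex.mk (ModuleCat.ofHom f) (ModuleCat.ofHom g)
    (by ext x; exact hfg.apply_apply_eq_zero x)
  have hS : S.ShortExact :=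
    { exact := (ShortComplex.ShortExact.moduleCat_exact_iff_function_exact S).2 hfg
      mono_f := (ModuleCat.mono_iff_injective _).2 hf
      epi_g := (ModuleCat.epi_iff_surjective _).2 hg }
  have h := tensorComplex_shortExact (ModuleCat.of A M) hS
  refine ⟨(h.δ (i + 1) i rfl).hom, ?_, ?_, ?_⟩
  · exact (ShortComplex.ShortExact.moduleCat_exact_iff_function_exact _).1
      (h.homology_exact₃ (i + 1) i rfl)
  · exact (ShortComplex.ShortExact.moduleCat_exact_iff_function_exact _).1
      (h.homology_exact₁ (i + 1) i rfl)
  · exact (ShortComplex.ShortExact.moduleCat_exact_iff_function_exact _).1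
      (h.homology_exact₂ i)

lemma subsingleton_torMod_succ [Module.Flat A X] (i : ℕ) :
    Subsingleton (TorMod A M (i + 1) X) := by
  rw [← ModuleCat.isZero_iff_subsingleton]
  rw [← HomologicalComplex.exactAt_iff_isZero_homology]
  rw [HomologicalComplex.exactAt_iff' _ (i + 2) (i + 1) i (by simp) (by simp)]
  exact Module.Flat.lTensor_shortComplex_exact (ModuleCat.of A X) _
    ((projectiveResolution (ModuleCat.of A M)).exact_succ i)

/-- The augmentation `Tor 0 X M ⟶ X ⊗ M`, as a morphism of `ModuleCat`. -/
def torZeroHom (M X : ModuleCat.{0} A) :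
    (tensorComplex M X).homology 0 ⟶ ((tensoringLeft (ModuleCat.{0} A)).obj X).obj M :=
  (ChainComplex.isoHomologyι₀ _).hom ≫
    (projectiveResolution M).fromLeftDerivedZero' ((tensoringLeft (ModuleCat.{0} A)).obj X)

lemma isIso_torZeroHom (M X : ModuleCat.{0} A) : IsIso (torZeroHom M X) := by
  have : Limits.PreservesFiniteColimits ((tensoringLeft (ModuleCat.{0} A)).obj X) :=
    inferInstanceAs (Limits.PreservesFiniteColimits (tensorLeft X))
  unfold torZeroHom
  infer_instance

lemma torZeroHom_naturality (M : ModuleCat.{0} A) {X Y : ModuleCat.{0} A} (f : X ⟶ Y) :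
    HomologicalComplex.homologyMap (tensorComplexMap M f) 0 ≫ torZeroHom M Y =
      torZeroHom M X ≫ ((tensoringLeft (ModuleCat.{0} A)).map f).app M := by
  have key : HomologicalComplex.opcyclesMap (tensorComplexMap M f) 0 ≫
      (projectiveResolution M).fromLeftDerivedZero' ((tensoringLeft (ModuleCat.{0} A)).obj Y) =
      (projectiveResolution M).fromLeftDerivedZero' ((tensoringLeft (ModuleCat.{0} A)).obj X) ≫
        ((tensoringLeft (ModuleCat.{0} A)).map f).app M := by
    rw [← cancel_epi (HomologicalComplex.pOpcycles _ _)]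
    rw [HomologicalComplex.p_opcyclesMap_assoc,
      ProjectiveResolution.pOpcycles_comp_fromLeftDerivedZero',
      ProjectiveResolution.pOpcycles_comp_fromLeftDerivedZero'_assoc]
    exact (((tensoringLeft (ModuleCat.{0} A)).map f).naturality
      ((projectiveResolution M).π.f 0)).symm
  have h : HomologicalComplex.homologyMap (tensorComplexMap M f) 0 ≫
      (ChainComplex.isoHomologyι₀ _).hom = (ChainComplex.isoHomologyι₀ _).hom ≫
        HomologicalComplex.opcyclesMap (tensorComplexMap M f) 0 :=
    HomologicalComplex.homologyι_naturality _ _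
  unfold torZeroHom
  rw [← Category.assoc, h, Category.assoc, key, Category.assoc]

/-- The augmentation `Tor 0 X M ≃ X ⊗ M`. -/
def torZeroEquiv (X : Type) [AddCommGroup X] [Module A X] : TorMod A M 0 X ≃ₗ[A] X ⊗[A] M :=
  have := isIso_torZeroHom (ModuleCat.of A M) (ModuleCat.of A X)
  (asIso (torZeroHom (ModuleCat.of A M) (ModuleCat.of A X))).toLinearEquiv

lemma torZeroEquiv_naturality (f : X →ₗ[A] Y) (t : TorMod A M 0 X) :
    torZeroEquiv M Y (torMap M 0 f t) = f.rTensor M (torZeroEquiv M X t) :=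
  congrArg (fun φ => φ.hom t) (torZeroHom_naturality (ModuleCat.of A M) (ModuleCat.ofHom f))

lemma subsingleton_tor_iff (i : ℕ) :
    Subsingleton (((Tor (ModuleCat.{0} A) i).obj (ModuleCat.of A X)).obj (ModuleCat.of A M)) ↔
      Subsingleton (TorMod A M i X) :=
  ((projectiveResolution (ModuleCat.of A M)).isoLeftDerivedObj
    ((tensoringLeft (ModuleCat.{0} A)).obj (ModuleCat.of A X)) i).toLinearEquiv.toEquiv.subsingleton_congr

end TorAux

namespace TorAux
open TensorProduct
variable {A : Type} [CommRing A]

section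
variable (M : Type) [AddCommGroup M] [Module A M]
variable {X Y Q : Type} [AddCommGroup X] [Module A X] [AddCommGroup Y] [Module A Y]
  [AddCommGroup Q] [Module A Q]

lemma subsingleton_torMod_one_iff [Module.Flat A Q] {f : Y →ₗ[A] Q} {g : Q →ₗ[A] X}
    (hf : Function.Injective f) (hg : Function.Surjective g) (hfg : Function.Exact f g) :
    Subsingleton (TorMod A M 1 X) ↔ Function.Injective (f.rTensor M) := by
  obtain ⟨δ, h1, h2, -⟩ := torMap_exact M f g hf hg hfg 0
  have hQ : Subsingleton (TorMod A M (0 + 1) Q) := subsingleton_torMod_succ M 0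
  have hδ : Function.Injective δ := by
    rw [injective_iff_map_eq_zero]
    intro t ht
    obtain ⟨s, rfl⟩ := (h1 t).1 ht
    rw [Subsingleton.elim s 0, map_zero]
  have hinj : Function.Injective (f.rTensor M) ↔ Function.Injective (torMap M 0 f) := by
    have : ⇑(torZeroEquiv M Q) ∘ ⇑(torMap M 0 f) = ⇑(f.rTensor M) ∘ ⇑(torZeroEquiv M Y) := by
      funext t
      exact torZeroEquiv_naturality M f t
    rw [← Function.Injective.of_comp_iff (torZeroEquiv M Q).injective, this,
      Function.Injective.of_comp_iff' _ (torZeroEquiv M Y).bijective]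
  rw [hinj]
  constructor
  · intro h
    rw [injective_iff_map_eq_zero]
    intro t ht
    obtain ⟨s, rfl⟩ := (h2 t).1 ht
    rw [Subsingleton.elim (α := TorMod A M (0 + 1) X) s 0, map_zero]
  · intro h
    refine ⟨fun s t => hδ (h ?_)⟩
    rw [h2.apply_apply_eq_zero, h2.apply_apply_eq_zero]

lemma exists_flat_presentation (X : Type) [AddCommGroup X] [Module A X] :
    ∃ (Y Q : Type) (_ : AddCommGroup Y) (_ : Module A Y) (_ : AddCommGroup Q) (_ : Module A Q)
      (f : Y →ₗ[A] Q) (g : Q →ₗ[A] X), Module.Flat A Q ∧ Function.Injective f ∧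
      Function.Surjective g ∧ Function.Exact f g :=
  ⟨LinearMap.ker (Finsupp.linearCombination A (id : X → X)), X →₀ A, inferInstance, inferInstance,
    inferInstance, inferInstance, Submodule.subtype _, Finsupp.linearCombination A (id : X → X),
    inferInstance, Submodule.subtype_injective _,
    Finsupp.linearCombination_id_surjective A X, LinearMap.exact_subtype_ker_map _⟩

lemma torMap_injective_δ [Module.Flat A Q] {i : ℕ} {g : Q →ₗ[A] X}
    {δ : TorMod A M (i + 1) X →ₗ[A] TorMod A M i Y}
    (h : Function.Exact (torMap M (i + 1) g) δ) : Function.Injective δ := by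
  have hQ : Subsingleton (TorMod A M (i + 1) Q) := subsingleton_torMod_succ M i
  rw [injective_iff_map_eq_zero]
  intro t ht
  obtain ⟨s, rfl⟩ := (h t).1 ht
  rw [Subsingleton.elim s 0, map_zero]

lemma subsingleton_torMod_succ_of_syzygy [Module.Flat A Q] {f : Y →ₗ[A] Q} {g : Q →ₗ[A] X}
    (hf : Function.Injective f) (hg : Function.Surjective g) (hfg : Function.Exact f g) (i : ℕ) :
    Subsingleton (TorMod A M (i + 2) X) ↔ Subsingleton (TorMod A M (i + 1) Y) := by
  obtain ⟨δ, h1, h2, -⟩ := torMap_exact M f g hf hg hfg (i + 1)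
  have hδ := torMap_injective_δ M h1
  have hQ : Subsingleton (TorMod A M (i + 1) Q) := subsingleton_torMod_succ M i
  constructor
  · intro h
    refine subsingleton_of_forall_eq 0 fun t => ?_
    obtain ⟨s, rfl⟩ := (h2 t).1 (Subsingleton.elim _ _)
    rw [Subsingleton.elim (α := TorMod A M (i + 1 + 1) X) s 0, map_zero]
  · intro h
    exact hδ.subsingleton

end

section
variable {M M' : Type} [AddCommGroup M] [Module A M] [AddCommGroup M'] [Module A M']
variable {r : A} {π : M →ₗ[A] M'}

lemma lTensor_lsmul (X : Type) [AddCommGroup X] [Module A X] (t : X ⊗[A] M) :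
    (LinearMap.lsmul A M r).lTensor X t = r • t := by
  have : (LinearMap.lsmul A M r).lTensor X = LinearMap.lsmul A (X ⊗[A] M) r := by
    ext x m
    simp
  rw [this]
  rfl

lemma smul_tensor_eq_zero_of_flat (hr : IsSMulRegular M r) {Q : Type} [AddCommGroup Q]
    [Module A Q] [Module.Flat A Q] {t : Q ⊗[A] M} (ht : r • t = 0) : t = 0 := by
  have := Module.Flat.lTensor_preserves_injective_linearMap (M := Q) (LinearMap.lsmul A M r) hr
  apply this
  rw [lTensor_lsmul, ht, map_zero]

lemma exists_smul_eq_of_lTensor_eq_zero (hπ : Function.Surjective π)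
    (hrπ : Function.Exact (LinearMap.lsmul A M r) π) {X : Type} [AddCommGroup X]
    [Module A X] {t : X ⊗[A] M} (ht : π.lTensor X t = 0) : ∃ s, t = r • s := by
  obtain ⟨s, rfl⟩ := (lTensor_exact X hrπ hπ t).1 ht
  exact ⟨s, lTensor_lsmul X s⟩

lemma lTensor_smul_eq_zero (hrπ : Function.Exact (LinearMap.lsmul A M r) π) {X : Type}
    [AddCommGroup X] [Module A X] (t : X ⊗[A] M) : π.lTensor X (r • t) = 0 := by
  rw [← lTensor_lsmul, ← LinearMap.comp_apply, ← LinearMap.lTensor_comp, hrπ.linearMap_comp_eq_zero]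
  simp

lemma lTensor_rTensor_comm {X Y : Type} [AddCommGroup X] [Module A X] [AddCommGroup Y]
    [Module A Y] (f : X →ₗ[A] Y) (t : X ⊗[A] M) :
    f.rTensor M' (π.lTensor X t) = π.lTensor Y (f.rTensor M t) := by
  rw [← LinearMap.comp_apply, ← LinearMap.comp_apply, LinearMap.rTensor_comp_lTensor,
    LinearMap.lTensor_comp_rTensor]

/-- If `Tor (i+1) X (M/rM)` vanishes for an `M`-regular element `r`, then `r` acts injectively on
`Tor i X M`. -/
lemma smul_eq_zero_torMod (hr : IsSMulRegular M r) (hπ : Function.Surjective π)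
    (hrπ : Function.Exact (LinearMap.lsmul A M r) π) (i : ℕ) :
    ∀ (X : Type) [AddCommGroup X] [Module A X], Subsingleton (TorMod A M' (i + 1) X) →
      ∀ t : TorMod A M i X, r • t = 0 → t = 0 := by
  induction i with
  | zero =>
    intro X _ _ h t ht
    obtain ⟨Y, Q, _, _, _, _, f, g, _, hf, hg, hfg⟩ := exists_flat_presentation (A := A) X
    rw [zero_add, subsingleton_torMod_one_iff M' hf hg hfg] at h
    suffices ∀ x : X ⊗[A] M, r • x = 0 → x = 0 by
      apply (torZeroEquiv M X).injective
      rw [map_zero]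
      apply this
      rw [← map_smul, ht, map_zero]
    intro x hx
    obtain ⟨q, rfl⟩ := LinearMap.rTensor_surjective M hg x
    rw [← map_smul] at hx
    obtain ⟨y, hy⟩ := (rTensor_exact M hfg hg _).1 hx
    obtain ⟨y', rfl⟩ := exists_smul_eq_of_lTensor_eq_zero (t := y) hπ hrπ (by
      apply h
      rw [lTensor_rTensor_comm, hy, lTensor_smul_eq_zero hrπ, map_zero])
    have : f.rTensor M y' - q = 0 := smul_tensor_eq_zero_of_flat hr (by
      rw [smul_sub, ← hy, map_smul, sub_self])
    rw [← sub_eq_zero.1 this]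
    exact (rTensor_exact M hfg hg).apply_apply_eq_zero y'
  | succ i ih =>
    intro X _ _ h t ht
    obtain ⟨Y, Q, _, _, _, _, f, g, _, hf, hg, hfg⟩ := exists_flat_presentation (A := A) X
    obtain ⟨δ, h1, -, -⟩ := torMap_exact M f g hf hg hfg i
    apply torMap_injective_δ M h1
    rw [map_zero]
    apply ih Y ((subsingleton_torMod_succ_of_syzygy M' hf hg hfg i).1 h)
    rw [← map_smul, ht, map_zero]

/-- If `Tor (i+1) X M` vanishes and the `M`-regular element `r` acts injectively on `Tor i X M`,
then `Tor (i+1) X (M/rM)` vanishes. -/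
lemma subsingleton_torMod_quotient (hr : IsSMulRegular M r) (hπ : Function.Surjective π)
    (hrπ : Function.Exact (LinearMap.lsmul A M r) π) (i : ℕ) :
    ∀ (X : Type) [AddCommGroup X] [Module A X], Subsingleton (TorMod A M (i + 1) X) →
      (∀ t : TorMod A M i X, r • t = 0 → t = 0) → Subsingleton (TorMod A M' (i + 1) X) := by
  induction i with
  | zero =>
    intro X _ _ h hX
    obtain ⟨Y, Q, _, _, _, _, f, g, _, hf, hg, hfg⟩ := exists_flat_presentation (A := A) X
    rw [zero_add, subsingleton_torMod_one_iff _ hf hg hfg] at h ⊢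
    have hX' : ∀ x : X ⊗[A] M, r • x = 0 → x = 0 := by
      intro x hx
      apply (torZeroEquiv M X).symm.injective
      rw [map_zero]
      apply hX
      rw [← map_smul, hx, map_zero]
    rw [injective_iff_map_eq_zero]
    intro y hy
    obtain ⟨y, rfl⟩ := LinearMap.lTensor_surjective Y hπ y
    rw [lTensor_rTensor_comm] at hy
    obtain ⟨q, hq⟩ := exists_smul_eq_of_lTensor_eq_zero hπ hrπ hy
    have hgq : g.rTensor M q = 0 := hX' _ (by
      rw [← map_smul, ← hq]
      exact (rTensor_exact M hfg hg).apply_apply_eq_zero y)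
    obtain ⟨y', rfl⟩ := (rTensor_exact M hfg hg _).1 hgq
    rw [← map_smul] at hq
    rw [h hq, lTensor_smul_eq_zero hrπ]
  | succ i ih =>
    intro X _ _ h hX
    obtain ⟨Y, Q, _, _, _, _, f, g, _, hf, hg, hfg⟩ := exists_flat_presentation (A := A) X
    rw [subsingleton_torMod_succ_of_syzygy _ hf hg hfg] at h ⊢
    refine ih Y h fun t ht => ?_
    obtain ⟨δ, h1, h2, -⟩ := torMap_exact M f g hf hg hfg i
    have hft : torMap M i f t = 0 := by
      have hrft : r • torMap M i f t = 0 := by rw [← map_smul, ht, map_zero]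
      cases i with
      | zero =>
        apply (torZeroEquiv M Q).injective
        rw [map_zero]
        apply smul_tensor_eq_zero_of_flat hr
        rw [← map_smul, hrft, map_zero]
      | succ i =>
        have := subsingleton_torMod_succ (A := A) M (X := Q) i
        exact Subsingleton.elim _ _
    obtain ⟨s, rfl⟩ := (h2 t).1 hft
    rw [← map_smul] at ht
    have hs := (map_eq_zero_iff (M := TorMod A M (i + 1) X) δ (torMap_injective_δ M h1)).1 ht
    rw [hX s hs, map_zero]

end

end TorAux

namespace TorAux
open TensorProduct

section Koszul
variable {k : Type} [Field k] {n : ℕ}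

/-- The ideal generated by the variables with index in `s`. -/
abbrev varIdeal (k : Type) [Field k] {n : ℕ} (s : Finset (Fin n)) :
    Ideal (MvPolynomial (Fin n) k) :=
  Ideal.span (MvPolynomial.X '' (s : Set (Fin n)))

/-- The quotient by the variables with index in `s`. -/
abbrev VarQuot (k : Type) [Field k] {n : ℕ} (s : Finset (Fin n)) : Type :=
  MvPolynomial (Fin n) k ⧸ varIdeal k s

lemma varIdeal_insert (s : Finset (Fin n)) (j : Fin n) :
    varIdeal k (insert j s) = Ideal.span {X j} ⊔ varIdeal k s := by
  rw [varIdeal, Finset.coe_insert, Set.image_insert_eq, Ideal.span_insert]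

lemma mem_varIdeal_of_mul_X_mem {s : Finset (Fin n)} {j : Fin n} (hj : j ∉ s)
    {f : MvPolynomial (Fin n) k} (h : f * X j ∈ varIdeal k s) : f ∈ varIdeal k s := by
  rw [mem_ideal_span_X_image] at h ⊢
  intro m hm
  obtain ⟨i, hi, hmi⟩ := h (m + Finsupp.single j 1) (by
    rw [support_mul_X]
    exact Finset.mem_map.2 ⟨m, hm, rfl⟩)
  refine ⟨i, hi, ?_⟩
  have hij : j ≠ i := fun hij => hj (by rw [hij]; exact hi)
  simpa [Finsupp.single_eq_of_ne' hij] using hmi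

lemma lsmul_X_injective {s : Finset (Fin n)} {j : Fin n} (hj : j ∉ s) :
    Function.Injective (LinearMap.lsmul (MvPolynomial (Fin n) k) (VarQuot k s) (X j)) := by
  rw [injective_iff_map_eq_zero]
  intro x hx
  obtain ⟨f, rfl⟩ := Ideal.Quotient.mk_surjective x
  rw [Ideal.Quotient.eq_zero_iff_mem]
  apply mem_varIdeal_of_mul_X_mem hj
  rw [mul_comm, ← Ideal.Quotient.eq_zero_iff_mem]
  exact hx

lemma varIdeal_le_insert (s : Finset (Fin n)) (j : Fin n) :
    varIdeal k s ≤ varIdeal k (insert j s) := by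
  rw [varIdeal_insert]
  exact le_sup_right

/-- The projection modulo one further variable. -/
def varProj (s : Finset (Fin n)) (j : Fin n) :
    VarQuot k s →ₗ[MvPolynomial (Fin n) k] VarQuot k (insert j s) :=
  Submodule.factor (varIdeal_le_insert s j)

lemma varProj_surjective (s : Finset (Fin n)) (j : Fin n) :
    Function.Surjective (varProj (k := k) s j) :=
  Submodule.factor_surjective (varIdeal_le_insert s j)

lemma varProj_exact (s : Finset (Fin n)) (j : Fin n) :
    Function.Exact (LinearMap.lsmul (MvPolynomial (Fin n) k) (VarQuot k s) (X j))
      (varProj s j) := by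
  intro x
  obtain ⟨f, rfl⟩ := Ideal.Quotient.mk_surjective x
  have h1 : varProj s j (Ideal.Quotient.mk _ f) = 0 ↔ f ∈ varIdeal k (insert j s) :=
    Ideal.Quotient.eq_zero_iff_mem
  rw [h1, varIdeal_insert, Submodule.mem_sup]
  constructor
  · rintro ⟨y, hy, z, hz, rfl⟩
    obtain ⟨c, rfl⟩ := Ideal.mem_span_singleton'.1 hy
    refine ⟨Ideal.Quotient.mk _ c, ?_⟩
    rw [map_add, Ideal.Quotient.eq_zero_iff_mem.2 hz, add_zero, mul_comm, map_mul]
    rfl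
  · rintro ⟨y, hy⟩
    obtain ⟨c, rfl⟩ := Ideal.Quotient.mk_surjective y
    refine ⟨X j * c, Ideal.mul_mem_right _ _ (Ideal.mem_span_singleton_self _), f - X j * c, ?_,
      by ring⟩
    rw [← Ideal.Quotient.eq_zero_iff_mem, map_sub, sub_eq_zero, ← hy]
    rfl

/-- The quotient by no variable is the polynomial ring. -/
def varQuotEmptyEquiv : VarQuot k (∅ : Finset (Fin n)) ≃ₗ[MvPolynomial (Fin n) k]
    MvPolynomial (Fin n) k :=
  Submodule.quotEquivOfEqBot _ (by simp [varIdeal])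

instance : Module.Flat (MvPolynomial (Fin n) k) (VarQuot k (∅ : Finset (Fin n))) :=
  Module.Flat.of_linearEquiv varQuotEmptyEquiv

variable (M : Type) [AddCommGroup M] [Module (MvPolynomial (Fin n) k) M]

lemma subsingleton_torMod_varQuot (s : Finset (Fin n)) :
    ∀ i, s.card < i → Subsingleton (TorMod (MvPolynomial (Fin n) k) M i (VarQuot k s)) := by
  induction s using Finset.induction_on with
  | empty =>
    intro i hi
    obtain ⟨i, rfl⟩ := Nat.exists_eq_succ_of_ne_zero (by omega : i ≠ 0)
    exact subsingleton_torMod_succ M i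
  | insert j s hj ih =>
    intro i hi
    rw [Finset.card_insert_of_notMem hj] at hi
    obtain ⟨i, rfl⟩ := Nat.exists_eq_succ_of_ne_zero (by omega : i ≠ 0)
    obtain ⟨δ, h1, h2, -⟩ := torMap_exact M _ _ (lsmul_X_injective hj) (varProj_surjective s j)
      (varProj_exact (k := k) s j) i
    have a1 := ih i (by omega)
    have a2 := ih (i + 1) (by omega)
    refine subsingleton_of_forall_eq 0 fun t => ?_
    obtain ⟨u, rfl⟩ := (h1 t).1 (Subsingleton.elim _ _)
    rw [Subsingleton.elim u 0, map_zero]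

lemma exists_torMod_varQuot_socle {x : M} (hx : x ≠ 0)
    (hX : ∀ j : Fin n, (X j : MvPolynomial (Fin n) k) • x = 0) (s : Finset (Fin n)) :
    ∀ i, s.card = i → ∃ t : TorMod (MvPolynomial (Fin n) k) M i (VarQuot k s), t ≠ 0 ∧
      ∀ j : Fin n, (X j : MvPolynomial (Fin n) k) • t = 0 := by
  induction s using Finset.induction_on with
  | empty =>
    intro i hi
    obtain rfl : i = 0 := by simpa using hi.symm
    let e : TorMod (MvPolynomial (Fin n) k) M 0 (VarQuot k (∅ : Finset (Fin n)))
        ≃ₗ[MvPolynomial (Fin n) k] M :=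
      (torZeroEquiv M _).trans
        ((TensorProduct.congr varQuotEmptyEquiv (LinearEquiv.refl _ _)).trans
          (TensorProduct.lid _ _))
    refine ⟨e.symm x, fun h => hx ?_, fun j => ?_⟩
    · rw [← e.apply_symm_apply x, h, map_zero]
    · rw [← map_smul, hX, map_zero]
  | insert j s hj ih =>
    intro i hi
    rw [Finset.card_insert_of_notMem hj] at hi
    subst hi
    obtain ⟨t, ht, htX⟩ := ih _ rfl
    obtain ⟨δ, h1, h2, -⟩ := torMap_exact M _ _ (lsmul_X_injective hj) (varProj_surjective s j)
      (varProj_exact (k := k) s j) s.card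
    have a := subsingleton_torMod_varQuot (k := k) M s (s.card + 1) (by omega)
    have hδ : Function.Injective δ := by
      rw [injective_iff_map_eq_zero]
      intro u hu
      obtain ⟨v, rfl⟩ := (h1 u).1 hu
      rw [Subsingleton.elim v 0, map_zero]
    obtain ⟨u, rfl⟩ := (h2 t).1 (by rw [torMap_smul, htX])
    refine ⟨u, fun hu => ht (by rw [hu, map_zero]), fun l => hδ ?_⟩
    rw [map_smul, htX, map_zero]

/-- The ideal generated by all the variables. -/
abbrev allVars (k : Type) [Field k] (n : ℕ) : Ideal (MvPolynomial (Fin n) k) :=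
  Ideal.span (Set.range X)

lemma varIdeal_univ : varIdeal k (Finset.univ : Finset (Fin n)) = allVars k n := by
  rw [varIdeal, Finset.coe_univ, Set.image_univ]

lemma subsingleton_torMod_congr {A : Type} [CommRing A] (M : Type) [AddCommGroup M] [Module A M]
    {I J : Ideal A} (h : I = J) (i : ℕ) :
    Subsingleton (TorMod A M i (A ⧸ I)) ↔ Subsingleton (TorMod A M i (A ⧸ J)) := by
  subst h
  rfl

lemma subsingleton_torMod_residue {i : ℕ} (hi : n < i) :
    Subsingleton (TorMod (MvPolynomial (Fin n) k) M i (MvPolynomial (Fin n) k ⧸ allVars k n)) := by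
  have := subsingleton_torMod_varQuot (k := k) (n := n) M Finset.univ i (by simpa using hi)
  exact (subsingleton_torMod_congr M varIdeal_univ i).1 this

lemma eq_zero_of_subsingleton_torMod
    (h : Subsingleton (TorMod (MvPolynomial (Fin n) k) M n (MvPolynomial (Fin n) k ⧸ allVars k n)))
    {x : M} (hX : ∀ j : Fin n, (X j : MvPolynomial (Fin n) k) • x = 0) : x = 0 := by
  by_contra hx
  obtain ⟨t, ht, -⟩ := exists_torMod_varQuot_socle M hx hX Finset.univ n (by simp)
  rw [← subsingleton_torMod_congr M varIdeal_univ] at h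
  exact ht (Subsingleton.elim _ _)

end Koszul
end TorAux

namespace TorAux
open TensorProduct RingTheory.Sequence
open scoped Pointwise
section
variable {k : Type} [Field k] {n : ℕ}

lemma smul_torMod_residue {r : MvPolynomial (Fin n) k} (hr : r ∈ allVars k n)
    (M : Type) [AddCommGroup M] [Module (MvPolynomial (Fin n) k) M] (i : ℕ)
    (t : TorMod (MvPolynomial (Fin n) k) M i (MvPolynomial (Fin n) k ⧸ allVars k n)) :
    r • t = 0 := by
  have h : LinearMap.lsmul (MvPolynomial (Fin n) k) (MvPolynomial (Fin n) k ⧸ allVars k n) r =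
      LinearMap.lsmul (MvPolynomial (Fin n) k) (MvPolynomial (Fin n) k ⧸ allVars k n) 0 := by
    ext
    change Ideal.Quotient.mk (allVars k n) (r * 1) = Ideal.Quotient.mk (allVars k n) (0 * 1)
    rw [mul_one, zero_mul, map_zero]
    exact Ideal.Quotient.eq_zero_iff_mem.2 hr
  rw [← torMap_smul, h, torMap_smul, zero_smul]

/-- A weakly regular sequence of length `δ` in the irrelevant ideal forces
`Tor i k M = 0` for `i > n - δ`. -/
lemma subsingleton_torMod_of_isWeaklyRegular (rs : List (MvPolynomial (Fin n) k)) :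
    ∀ (M : Type) [AddCommGroup M] [Module (MvPolynomial (Fin n) k) M],
      (∀ r ∈ rs, r ∈ allVars k n) → IsWeaklyRegular M rs → ∀ i, n < i + rs.length →
      Subsingleton (TorMod (MvPolynomial (Fin n) k) M i
        (MvPolynomial (Fin n) k ⧸ allVars k n)) := by
  induction rs with
  | nil =>
    intro M _ _ _ _ i hi
    exact subsingleton_torMod_residue M (by simpa using hi)
  | cons r rs ih =>
    intro M _ _ hm hreg i hi
    rw [isWeaklyRegular_cons_iff] at hreg
    have h := ih (QuotSMulTop r M) (fun x hx => hm x (List.mem_cons_of_mem _ hx)) hreg.2 (i + 1)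
      (by rw [List.length_cons] at hi; omega)
    refine subsingleton_of_forall_eq 0 fun t => ?_
    exact smul_eq_zero_torMod hreg.1 (Submodule.mkQ_surjective _)
      (LinearMap.exact_lsmul_mkQ_smul_top _ r) i _ h t
      (smul_torMod_residue (hm r List.mem_cons_self) M i t)

lemma exists_isSMulRegular_of_subsingleton_torMod (M : Type) [AddCommGroup M]
    [Module (MvPolynomial (Fin n) k) M] [Module.Finite (MvPolynomial (Fin n) k) M]
    (h : Subsingleton (TorMod (MvPolynomial (Fin n) k) M n
      (MvPolynomial (Fin n) k ⧸ allVars k n))) :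
    ∃ r ∈ allVars k n, IsSMulRegular M r := by
  have hsub : Subsingleton ((MvPolynomial (Fin n) k ⧸ allVars k n)
      →ₗ[MvPolynomial (Fin n) k] M) := by
    refine subsingleton_of_forall_eq 0 fun φ => ?_
    ext
    refine eq_zero_of_subsingleton_torMod M h fun j => ?_
    change X j • φ 1 = 0
    rw [← map_smul]
    convert map_zero φ
    change Ideal.Quotient.mk (allVars k n) (X j * 1) = 0
    rw [mul_one, Ideal.Quotient.eq_zero_iff_mem]
    exact Ideal.subset_span ⟨j, rfl⟩
  obtain ⟨r, hr, hreg⟩ := IsSMulRegular.subsingleton_linearMap_iff.1 hsub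
  rw [Ideal.annihilator_quotient] at hr
  exact ⟨r, hr, hreg⟩

/-- Vanishing of `Tor i k M` for `i > n - δ` yields a regular sequence of length `δ`. -/
lemma exists_isWeaklyRegular_of_subsingleton_torMod (δ : ℕ) :
    ∀ (M : Type) [AddCommGroup M] [Module (MvPolynomial (Fin n) k) M]
      [Module.Finite (MvPolynomial (Fin n) k) M], δ ≤ n →
      (∀ i, 1 ≤ i → n < i + δ → Subsingleton (TorMod (MvPolynomial (Fin n) k) M i
        (MvPolynomial (Fin n) k ⧸ allVars k n))) →
      ∃ rs : List (MvPolynomial (Fin n) k), rs.length = δ ∧ (∀ r ∈ rs, r ∈ allVars k n) ∧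
        IsWeaklyRegular M rs := by
  induction δ with
  | zero =>
    intro M _ _ _ _ _
    exact ⟨[], rfl, by simp, IsWeaklyRegular.nil _ _⟩
  | succ δ ih =>
    intro M _ _ _ hδ h
    obtain ⟨r, hr, hreg⟩ := exists_isSMulRegular_of_subsingleton_torMod M
      (h n (by omega) (by omega))
    obtain ⟨rs, hlen, hrs, hrs'⟩ := ih (QuotSMulTop r M) (by omega) (by
      intro i hi hin
      obtain ⟨j, rfl⟩ := Nat.exists_eq_add_of_le' hi
      refine subsingleton_torMod_quotient hreg (Submodule.mkQ_surjective _)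
        (LinearMap.exact_lsmul_mkQ_smul_top _ r) j _ (h _ hi (by omega)) fun t _ => ?_
      have := h j (by omega) (by omega)
      exact Subsingleton.elim _ _)
    refine ⟨r :: rs, by simp [hlen], ?_, IsWeaklyRegular.cons hreg hrs'⟩
    simpa using ⟨hr, hrs⟩
end
end TorAux

namespace DimAux

lemma ringKrullDim_le_of_isIntegral (R B : Type) [CommRing R] [CommRing B] [Algebra R B]
    [Algebra.IsIntegral R B] : ringKrullDim B ≤ ringKrullDim R := by
  refine Order.krullDim_le_of_strictMono (PrimeSpectrum.comap (algebraMap R B)) fun P Q h => ?_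
  exact Ideal.IsIntegral.comap_lt_comap (R := R) (I := P.asIdeal) (J := Q.asIdeal) h

lemma ringKrullDim_eq_of_isIntegral (R B : Type) [CommRing R] [CommRing B] [IsDomain B]
    [Algebra R B]
    [Algebra.IsIntegral R B] (h : Function.Injective (algebraMap R B)) :
    ringKrullDim B = ringKrullDim R := by
  refine le_antisymm (ringKrullDim_le_of_isIntegral R B) ?_
  refine iSup_le fun l => ?_
  obtain ⟨P, hP, hPl⟩ := Ideal.exists_ideal_over_prime_of_isIntegral_of_isDomain (S := B)
    l.head.asIdeal (by rw [(RingHom.injective_iff_ker_eq_bot _).1 h]; exact bot_le)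
  have : P.LiesOver (RelSeries.head l).asIdeal := ⟨hPl.symm⟩
  obtain ⟨L, hL, -, -⟩ := Ideal.exists_ltSeries_of_hasGoingUp l P
  rw [← hL]
  exact Order.LTSeries.length_le_krullDim L

/-- The dimension of an affine domain is its transcendence degree. -/
lemma exists_ringKrullDim_eq_trdeg (k B : Type) [Field k] [CommRing B] [IsDomain B] [Algebra k B]
    [Algebra.FiniteType k B] : ∃ s : ℕ, ringKrullDim B = s ∧ Algebra.trdeg k B = s := by
  obtain ⟨s, g, hg, h_int⟩ := exists_integral_inj_algHom_of_fg k B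
  algebraize [g.toRingHom]
  have : IsScalarTower k (MvPolynomial (Fin s) k) B :=
    IsScalarTower.of_algebraMap_eq fun x => (g.commutes x).symm
  have hinj : Function.Injective (algebraMap (MvPolynomial (Fin s) k) B) := hg
  have : FaithfulSMul (MvPolynomial (Fin s) k) B :=
    (faithfulSMul_iff_algebraMap_injective _ _).2 hinj
  refine ⟨s, ?_, ?_⟩
  · rw [ringKrullDim_eq_of_isIntegral _ B hinj, MvPolynomial.ringKrullDim_of_isNoetherianRing]
    simp
  · have : Algebra.IsAlgebraic (MvPolynomial (Fin s) k) B := inferInstance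
    rw [← trdeg_add_eq k (MvPolynomial (Fin s) k) (A := B), trdeg_eq_zero_iff.2 this]
    simp

variable {k : Type} [Field k] {n : ℕ}

/-- A set of variables whose images form a transcendence basis. -/
lemma exists_rename_isTranscendenceBasis {B : Type} [CommRing B] [IsDomain B] [Algebra k B]
    (φ : MvPolynomial (Fin n) k →ₐ[k] B) (hφ : Function.Surjective φ) :
    ∃ (τ : Type) (c : τ → Fin n), Function.Injective c ∧
      IsTranscendenceBasis k (fun b => φ (X (c b))) := by
  have htop : Algebra.adjoin k (Set.range fun i => φ (X i)) = ⊤ := by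
    rw [← Function.comp_def, Set.range_comp, ← AlgHom.map_adjoin, MvPolynomial.adjoin_range_X,
      Algebra.map_top, (AlgHom.range_eq_top φ).2 hφ]
  have halg : Algebra.IsAlgebraic (Algebra.adjoin k (Set.range fun i => φ (X i))) B := by
    refine ⟨fun x => isAlgebraic_algebraMap (⟨x, by rw [htop]; trivial⟩ :
      Algebra.adjoin k (Set.range fun i => φ (X i)))⟩
  obtain ⟨t, hts, ht⟩ := exists_isTranscendenceBasis_subset (R := k) (Set.range fun i => φ (X i))
  choose c hc using fun b : t => hts b.2
  refine ⟨t, c, fun a b hab => Subtype.ext (by rw [← hc a, ← hc b, hab]), ?_⟩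
  simpa only [hc] using ht

lemma exists_rename_ringKrullDim {B : Type} [CommRing B] [IsDomain B] [Algebra k B]
    (φ : MvPolynomial (Fin n) k →ₐ[k] B) (hφ : Function.Surjective φ) :
    ∃ (τ : Type) (c : τ → Fin n) (s : ℕ), Function.Injective c ∧ ringKrullDim B = s ∧
      Cardinal.mk τ = s ∧ ∀ p : MvPolynomial τ k, φ (rename c p) = 0 → p = 0 := by
  have hft : Algebra.FiniteType k B := Algebra.FiniteType.of_surjective φ hφ
  obtain ⟨s, hs, hs'⟩ := exists_ringKrullDim_eq_trdeg k B
  obtain ⟨τ, c, hc, hτ⟩ := exists_rename_isTranscendenceBasis φ hφ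
  refine ⟨τ, c, s, hc, hs, by rw [hτ.cardinalMk_eq_trdeg, hs'], fun p hp => ?_⟩
  apply algebraicIndependent_iff.1 hτ.1 p
  rw [← hp, ← AlgHom.comp_apply]
  congr 1
  ext b
  simp

lemma card_le_ringKrullDim {B : Type} [CommRing B] [IsDomain B] [Algebra k B]
    (φ : MvPolynomial (Fin n) k →ₐ[k] B) (hφ : Function.Surjective φ) {τ : Type} {c : τ → Fin n}
    {s : ℕ} (hs : Cardinal.mk τ = s) (h : ∀ p : MvPolynomial τ k, φ (rename c p) = 0 → p = 0) :
    (s : WithBot ℕ∞) ≤ ringKrullDim B := by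
  have hft : Algebra.FiniteType k B := Algebra.FiniteType.of_surjective φ hφ
  obtain ⟨e, he, he'⟩ := exists_ringKrullDim_eq_trdeg k B
  have hI : AlgebraicIndependent k (fun b => φ (X (c b))) := by
    rw [algebraicIndependent_iff]
    intro p hp
    apply h
    rw [← hp, ← AlgHom.comp_apply]
    congr 1
    ext b
    simp
  have hcard := hI.cardinalMk_le_trdeg
  rw [hs, he'] at hcard
  rw [he]
  exact_mod_cast hcard

lemma ringKrullDim_le_of_rename {I J : Ideal (MvPolynomial (Fin n) k)} [I.IsPrime]
    (hIJ : ∀ (τ : Type) (c : τ → Fin n), Function.Injective c →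
      (∀ p : MvPolynomial τ k, rename c p ∈ J → p = 0) →
        ∀ p : MvPolynomial τ k, rename c p ∈ I → p = 0) :
    ringKrullDim (MvPolynomial (Fin n) k ⧸ J) ≤ ringKrullDim (MvPolynomial (Fin n) k ⧸ I) := by
  rw [ringKrullDim, Order.krullDim_eq_iSup_coheight]
  refine iSup_le fun P => ?_
  have hP : ((Order.coheight P : ℕ∞) : WithBot ℕ∞) =
      ringKrullDim ((MvPolynomial (Fin n) k ⧸ J) ⧸ P.asIdeal) := by
    rw [ringKrullDim_quotient, Order.coheight_eq_krullDim_Ici]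
    rfl
  rw [hP]
  let φ : MvPolynomial (Fin n) k →ₐ[k] ((MvPolynomial (Fin n) k ⧸ J) ⧸ P.asIdeal) :=
    (Ideal.Quotient.mkₐ k P.asIdeal).comp (Ideal.Quotient.mkₐ k J)
  have hφ : Function.Surjective φ :=
    (Ideal.Quotient.mkₐ_surjective k P.asIdeal).comp (Ideal.Quotient.mkₐ_surjective k J)
  obtain ⟨τ, c, s, hc, hs, hτ, hp⟩ := exists_rename_ringKrullDim
    (B := (MvPolynomial (Fin n) k ⧸ J) ⧸ P.asIdeal) φ hφ
  rw [hs]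
  refine card_le_ringKrullDim (Ideal.Quotient.mkₐ k I) (Ideal.Quotient.mkₐ_surjective k I) hτ
    fun p hpI => hIJ τ c hc (fun q hq => hp q ?_) p (Ideal.Quotient.eq_zero_iff_mem.1 hpI)
  change Ideal.Quotient.mk _ (Ideal.Quotient.mk J (rename c q)) = 0
  rw [Ideal.Quotient.eq_zero_iff_mem.2 hq, map_zero]

/-- The length of a regular sequence is bounded by the dimension of the support. -/
lemma length_le_supportDim {R : Type} [CommRing R] [IsNoetherianRing R] (rs : List R) :
    ∀ (M : Type) [AddCommGroup M] [Module R M] [Module.Finite R M],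
      RingTheory.Sequence.IsRegular M rs → (rs.length : WithBot ℕ∞) ≤ Module.supportDim R M := by
  induction rs with
  | nil =>
    intro M _ _ _ h
    have := h.nontrivial
    rw [List.length_nil, Nat.cast_zero]
    exact Order.krullDim_nonneg_iff.2 Module.nonempty_support_of_nontrivial.to_subtype
  | cons r rs ih =>
    intro M _ _ _ h
    rw [RingTheory.Sequence.isRegular_cons_iff] at h
    have h1 := ih _ h.2
    have h2 := Module.supportDim_quotSMulTop_succ_le_of_notMem_minimalPrimes (x := r)
      (M := M) fun p hp => h.1.notMem_of_mem_minimalPrimes hp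
    rw [List.length_cons, Nat.cast_add, Nat.cast_one]
    exact (add_le_add_left h1 1).trans h2

lemma length_le_ringKrullDim {R : Type} [CommRing R] [IsNoetherianRing R] {rs : List R}
    (h : RingTheory.Sequence.IsRegular R rs) : (rs.length : WithBot ℕ∞) ≤ ringKrullDim R := by
  rw [← Module.supportDim_self_eq_ringKrullDim]
  exact length_le_supportDim rs R h

end DimAux

namespace StarAux
open AffineSG TorAux DimAux RingTheory.Sequence

variable {k : Type} [Field k] {n : ℕ}

lemma mem_allVars_iff (f : MvPolynomial (Fin n) k) : f ∈ allVars k n ↔ coeff 0 f = 0 := by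
  rw [allVars, ← Set.image_univ, mem_ideal_span_X_image]
  constructor
  · intro h
    by_contra h0
    obtain ⟨i, -, hi⟩ := h 0 (mem_support_iff.2 h0)
    exact hi rfl
  · intro h m hm
    by_contra! h'
    have : m = 0 := Finsupp.ext fun i => h' i trivial
    exact mem_support_iff.1 hm (this ▸ h)

lemma exists_edeg_eq_minDeg {f : MvPolynomial (Fin n) k} (hf : f ≠ 0) :
    ∃ u ∈ f.support, u.degree = minDeg f := by
  have h : (edeg '' (f.support : Set (Fin n →₀ ℕ))).Nonempty :=
    (Finset.coe_nonempty.2 (support_nonempty.2 hf)).image _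
  obtain ⟨u, hu, hu'⟩ := Nat.sInf_mem h
  exact ⟨u, hu, by rw [minDeg, ← hu']; rfl⟩

lemma initialForm_ne_zero {f : MvPolynomial (Fin n) k} (hf : f ≠ 0) : initialForm f ≠ 0 := by
  obtain ⟨u, hu, hu'⟩ := exists_edeg_eq_minDeg hf
  intro h
  have := coeff_homogeneousComponent (minDeg f) f u
  rw [if_pos hu', ← initialForm, h, coeff_zero] at this
  exact mem_support_iff.1 hu this.symm

lemma initialForm_mem_allVars {f : MvPolynomial (Fin n) k} (h : f ∈ allVars k n) :
    initialForm f ∈ allVars k n := by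
  rw [mem_allVars_iff] at h ⊢
  rw [initialForm, coeff_homogeneousComponent, h, ite_self]

lemma starIdeal_le_allVars {I : Ideal (MvPolynomial (Fin n) k)} (hI : I ≤ allVars k n) :
    starIdeal I ≤ allVars k n := by
  rw [starIdeal, Ideal.span_le]
  rintro _ ⟨f, hf, -, rfl⟩
  exact initialForm_mem_allVars (hI hf)

/-- Passing to the initial ideal does not raise the dimension of a prime quotient. -/
lemma ringKrullDim_starIdeal_le (I : Ideal (MvPolynomial (Fin n) k)) [I.IsPrime] :
    ringKrullDim (MvPolynomial (Fin n) k ⧸ starIdeal I) ≤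
      ringKrullDim (MvPolynomial (Fin n) k ⧸ I) := by
  refine ringKrullDim_le_of_rename fun τ c hc hJ p hp => ?_
  by_contra hp0
  have hr : rename c p ≠ 0 := fun h => hp0 (rename_injective c hc (by rw [h, map_zero]))
  have h1 : initialForm (rename c p) ∈ starIdeal I := Ideal.subset_span ⟨_, hp, hr, rfl⟩
  rw [initialForm, ← rename_homogeneousComponent] at h1
  apply initialForm_ne_zero hr
  rw [initialForm, ← rename_homogeneousComponent, hJ _ h1, map_zero]

lemma moduleLength_eq_zero_iff (R M : Type) [CommRing R] [AddCommGroup M] [Module R M] :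
    moduleLength R M = 0 ↔ Subsingleton M := by
  rw [moduleLength, Order.krullDim_eq_zero_iff_of_orderBot, Submodule.subsingleton_iff R]

lemma bettiNumber_eq_zero_iff (M : Type) [AddCommGroup M] [Module (MvPolynomial (Fin n) k) M]
    (i : ℕ) : bettiNumber (MvPolynomial (Fin n) k) (allVars k n) M i = 0 ↔
      Subsingleton (TorMod (MvPolynomial (Fin n) k) M i
        (MvPolynomial (Fin n) k ⧸ allVars k n)) := by
  rw [bettiNumber, moduleLength_eq_zero_iff, subsingleton_tor_iff]

lemma ofList_smul_top {R : Type} [CommRing R] {m : Ideal R} (hm : m ≠ ⊤) {rs : List R}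
    (h : ∀ r ∈ rs, r ∈ m) : (⊤ : Submodule R R) ≠ Ideal.ofList rs • ⊤ := by
  intro h'
  apply hm
  rw [eq_top_iff]
  refine h'.le.trans ?_
  rw [Ideal.smul_eq_mul, Ideal.mul_top]
  exact Ideal.span_le.2 h

lemma quotMax_ne_top {I : Ideal (MvPolynomial (Fin n) k)} (hI : I ≤ allVars k n) :
    quotMax I ≠ ⊤ := by
  intro h
  have h1 := congrArg (Ideal.comap (Ideal.Quotient.mk I)) h
  rw [quotMax, Ideal.comap_map_of_surjective _ Ideal.Quotient.mk_surjective, Ideal.comap_top,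
    ← RingHom.ker_eq_comap_bot, Ideal.mk_ker, sup_eq_left.2 hI] at h1
  have h2 : (1 : MvPolynomial (Fin n) k) ∈ allVars k n := by rw [h1]; trivial
  rw [mem_allVars_iff, coeff_zero_one] at h2
  exact one_ne_zero h2

/-- Regular sequences on a quotient of the polynomial ring, inside the ideal of the variables. -/
lemma exists_isRegular_iff {I : Ideal (MvPolynomial (Fin n) k)} (hI : I ≤ allVars k n) (δ : ℕ) :
    (∃ rs : List (MvPolynomial (Fin n) k ⧸ I), rs.length = δ ∧ (∀ x ∈ rs, x ∈ quotMax I) ∧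
      IsRegular (MvPolynomial (Fin n) k ⧸ I) rs) ↔
    ∃ rs : List (MvPolynomial (Fin n) k), rs.length = δ ∧ (∀ x ∈ rs, x ∈ allVars k n) ∧
      IsWeaklyRegular (MvPolynomial (Fin n) k ⧸ I) rs := by
  constructor
  · rintro ⟨rs, hl, hm, hr⟩
    have : ∀ x : quotMax I, ∃ y : allVars k n, Ideal.Quotient.mk I y = x := by
      rintro ⟨x, hx⟩
      obtain ⟨y, hy, hyx⟩ := (Ideal.mem_map_iff_of_surjective _
        Ideal.Quotient.mk_surjective).1 hx
      exact ⟨⟨y, hy⟩, hyx⟩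
    choose g hg using this
    refine ⟨rs.attach.map fun x => (g ⟨x.val, hm x.val x.property⟩ : MvPolynomial (Fin n) k), by simpa using hl,
      ?_, ?_⟩
    · intro x hx
      obtain ⟨y, -, rfl⟩ := List.mem_map.1 hx
      exact (g _).2
    · rw [← isWeaklyRegular_map_algebraMap_iff (MvPolynomial (Fin n) k ⧸ I), List.map_map]
      convert hr.toIsWeaklyRegular
      conv_rhs => rw [← List.attach_map_subtype_val rs]
      exact List.map_congr_left fun x _ => hg _
  · rintro ⟨rs, hl, hm, hr⟩
    have hm' : ∀ x ∈ rs.map (algebraMap _ (MvPolynomial (Fin n) k ⧸ I)), x ∈ quotMax I := by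
      intro x hx
      obtain ⟨y, hy, rfl⟩ := List.mem_map.1 hx
      exact Ideal.mem_map_of_mem _ (hm y hy)
    exact ⟨rs.map (algebraMap _ _), by simpa using hl, hm',
      (isWeaklyRegular_map_algebraMap_iff _ _ rs).2 hr, ofList_smul_top (quotMax_ne_top hI) hm'⟩

/-- If vanishing of Betti numbers is inherited by `A/J`, then so are regular sequences. -/
lemma exists_isRegular_of_bettiNumber {I J : Ideal (MvPolynomial (Fin n) k)}
    (hI : I ≤ allVars k n) (hJ : J ≤ allVars k n)
    (hb : ∀ i, 1 ≤ i → bettiNumber (MvPolynomial (Fin n) k) (allVars k n)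
        (MvPolynomial (Fin n) k ⧸ I) i = bettiNumber (MvPolynomial (Fin n) k) (allVars k n)
        (MvPolynomial (Fin n) k ⧸ J) i)
    {rs : List (MvPolynomial (Fin n) k ⧸ I)} (hm : ∀ x ∈ rs, x ∈ quotMax I)
    (hr : IsRegular (MvPolynomial (Fin n) k ⧸ I) rs) :
    ∃ rs' : List (MvPolynomial (Fin n) k ⧸ J), rs'.length = rs.length ∧
      (∀ x ∈ rs', x ∈ quotMax J) ∧ IsRegular (MvPolynomial (Fin n) k ⧸ J) rs' := by
  have hn : rs.length ≤ n := by
    have h := (length_le_ringKrullDim hr).trans (ringKrullDim_quotient_le I)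
    rw [MvPolynomial.ringKrullDim_of_isNoetherianRing, ringKrullDim_eq_zero_of_field,
      zero_add, Nat.card_fin] at h
    exact_mod_cast h
  obtain ⟨as, hl, ham, har⟩ := (exists_isRegular_iff hI _).1 ⟨rs, rfl, hm, hr⟩
  refine (exists_isRegular_iff hJ _).2 (exists_isWeaklyRegular_of_subsingleton_torMod _ _ hn
    fun i h1 hi => ?_)
  rw [← bettiNumber_eq_zero_iff, ← hb i h1, bettiNumber_eq_zero_iff]
  exact subsingleton_torMod_of_isWeaklyRegular as _ ham har i (by omega)

lemma ringDepth_eq {R : Type} [CommRing R] [IsNoetherianRing R] {m : Ideal R} {rs : List R}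
    (hm : ∀ x ∈ rs, x ∈ m) (hr : IsRegular R rs) (hd : ringKrullDim R = rs.length) :
    ringDepth R m = rs.length := by
  refine le_antisymm (sSup_le ?_) (le_sSup ⟨rs, ⟨hm, hr⟩, rfl⟩)
  rintro _ ⟨as, ⟨-, ha⟩, rfl⟩
  have := length_le_ringKrullDim ha
  rw [hd] at this
  change (as.length : ℕ∞) ≤ rs.length
  exact_mod_cast this

lemma isPrime_famIdeal {d : ℕ} (g : Fin n → Fin d → ℕ) : (famIdeal k g).IsPrime :=
  RingHom.ker_isPrime _

lemma famIdeal_le_allVars {d : ℕ} {g : Fin n → Fin d → ℕ} (hg : ∀ i, g i ≠ 0) :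
    famIdeal k g ≤ allVars k n := by
  intro f hf
  rw [mem_allVars_iff, ← constantCoeff_eq]
  have h : (constantCoeff.comp (aeval (fun i => monomial (Finsupp.equivFunOnFinite.symm (g i))
      (1 : k)) : MvPolynomial (Fin n) k →ₐ[k] MvPolynomial (Fin d) k).toRingHom) =
      constantCoeff := by
    ext i
    · simp
    · have : Finsupp.equivFunOnFinite.symm (g i) ≠ 0 := fun h => hg i <| by
        funext j
        exact DFunLike.congr_fun h j
      simp [constantCoeff_monomial, this]
  rw [← h]
  rw [famIdeal, RingHom.mem_ker] at hf
  exact (congrArg constantCoeff hf).trans (map_zero _)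

end StarAux

open AffineSG MvPolynomial in
/-- If `S` is of homogeneous type (`β_i(k[S]) = β_i(gr_𝔪(k[S]))` for all `i ≥ 1`) and
`k[S]` is Cohen–Macaulay, then
`depth(gr_𝔪(k[S])) = depth(k[S]) = dim(k[S]) = dim(gr_𝔪(k[S]))`; in particular
`gr_𝔪(k[S])` is Cohen–Macaulay. -/
theorem homogeneous_type_CM {d r : ℕ} {k : Type} [Field k]
    (S : SimplicialAffineSemigroup d r)
    (hCM : IsCM (MvPolynomial (Fin (d + r)) k ⧸ S.definingIdeal k)
      (quotMax (S.definingIdeal k)))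
    (hbetti : ∀ i : ℕ, 1 ≤ i →
      bettiNumber (MvPolynomial (Fin (d + r)) k)
          (Ideal.span (Set.range (MvPolynomial.X : Fin (d + r) → MvPolynomial (Fin (d + r)) k)))
          (MvPolynomial (Fin (d + r)) k ⧸ S.definingIdeal k) i =
        bettiNumber (MvPolynomial (Fin (d + r)) k)
          (Ideal.span (Set.range (MvPolynomial.X : Fin (d + r) → MvPolynomial (Fin (d + r)) k)))
          (MvPolynomial (Fin (d + r)) k ⧸ starIdeal (S.definingIdeal k)) i) :
    ringDepth (MvPolynomial (Fin (d + r)) k ⧸ starIdeal (S.definingIdeal k))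
        (quotMax (starIdeal (S.definingIdeal k))) =
      ringDepth (MvPolynomial (Fin (d + r)) k ⧸ S.definingIdeal k)
        (quotMax (S.definingIdeal k)) ∧
    (ringDepth (MvPolynomial (Fin (d + r)) k ⧸ S.definingIdeal k)
        (quotMax (S.definingIdeal k)) : WithBot ℕ∞) =
      ringKrullDim (MvPolynomial (Fin (d + r)) k ⧸ S.definingIdeal k) ∧
    ringKrullDim (MvPolynomial (Fin (d + r)) k ⧸ S.definingIdeal k) =
      ringKrullDim (MvPolynomial (Fin (d + r)) k ⧸ starIdeal (S.definingIdeal k)) ∧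
    IsCM (MvPolynomial (Fin (d + r)) k ⧸ starIdeal (S.definingIdeal k))
      (quotMax (starIdeal (S.definingIdeal k))) := by
  have hI : S.definingIdeal k ≤ TorAux.allVars k (d + r) :=
    StarAux.famIdeal_le_allVars (k := k) S.gen_ne_zero
  have hp : (S.definingIdeal k).IsPrime := StarAux.isPrime_famIdeal S.gen
  obtain ⟨rs, hm, hr, hd⟩ := hCM
  obtain ⟨rs', hl, hm', hr'⟩ := StarAux.exists_isRegular_of_bettiNumber hI
    (StarAux.starIdeal_le_allVars hI) hbetti hm hr
  have hd' : ringKrullDim (MvPolynomial (Fin (d + r)) k ⧸ starIdeal (S.definingIdeal k)) =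
      rs'.length := by
    refine le_antisymm ?_ (DimAux.length_le_ringKrullDim hr')
    rw [hl, ← hd]
    exact StarAux.ringKrullDim_starIdeal_le _
  rw [StarAux.ringDepth_eq hm hr hd, StarAux.ringDepth_eq hm' hr' hd', hd, hd', hl]
  exact ⟨rfl, rfl, rfl, rs', hm', hr', hd'⟩
end
end

section
/- For the numerical semigroup S minimally generated by the geometric sequence a^r, a^{r−1}b, …, b^r (with gcd(a,b) = 1, a < b), the associated graded ring gr_𝔪(k[S]) of the semigroup ring k[S] with respect to its maximal ideal 𝔪 = (t^{m_1},…,t^{m_{r+1}}) is Cohen–Macaulay. -/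
open MvPolynomial CategoryTheory

set_option maxHeartbeats 1000000
set_option synthInstance.maxHeartbeats 400000

noncomputable section

/-- The defining ideal `𝔭` of the monomial curve given by the numerical semigroup minimally
generated by the geometric sequence `m_i = a^{r+1-i} b^{i-1}`, `i = 1, …, r+1`:
the kernel of `z_i ↦ t^{m_i}`. -/
noncomputable def geomKer (k : Type) [Field k] (a b r : ℕ) :
    Ideal (MvPolynomial (Fin (r + 1)) k) :=
  RingHom.ker (MvPolynomial.aeval
    (fun i : Fin (r + 1) =>
      (Polynomial.X : Polynomial k) ^ (a ^ (r - (i : ℕ)) * b ^ (i : ℕ))) :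
        MvPolynomial (Fin (r + 1)) k →ₐ[k] Polynomial k)

/-- The binomials `P_i = z_{i+1}^a − z_i^b`, `i = 1, …, r`. -/
noncomputable def geomP (k : Type) [Field k] (a b r : ℕ) (i : Fin r) :
    MvPolynomial (Fin (r + 1)) k :=
  MvPolynomial.X i.succ ^ a - MvPolynomial.X i.castSucc ^ b

/-- Normal factorizations (those using every generator but the first fewer than `a` times) with
respect to the geometric sequence are the unique longest ones. -/
theorem geom_normal_factorization_longest {a b : ℕ} (ha : 0 < a) (hab : a < b)
    (hco : Nat.Coprime a b) (r : ℕ) (u v : ℕ → ℕ) (hu : ∀ i, 0 < i → i ≤ r → u i < a)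
    (h : ∑ i ∈ Finset.range (r + 1), u i * (a ^ (r - i) * b ^ i) =
      ∑ i ∈ Finset.range (r + 1), v i * (a ^ (r - i) * b ^ i)) :
    ∑ i ∈ Finset.range (r + 1), v i ≤ ∑ i ∈ Finset.range (r + 1), u i ∧
      (∑ i ∈ Finset.range (r + 1), v i = ∑ i ∈ Finset.range (r + 1), u i →
        ∀ i ≤ r, u i = v i) := by
  induction r generalizing v with
  | zero => simp_all
  | succ r ih =>
    have hsplit : ∀ w : ℕ → ℕ,
        ∑ i ∈ Finset.range (r + 1 + 1), w i * (a ^ (r + 1 - i) * b ^ i) =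
          a * ∑ i ∈ Finset.range (r + 1), w i * (a ^ (r - i) * b ^ i) +
            w (r + 1) * b ^ (r + 1) := by
      intro w
      rw [Finset.sum_range_succ, Finset.mul_sum]
      congr 1
      · refine Finset.sum_congr rfl fun i hi => ?_
        rw [Nat.succ_sub (Nat.lt_succ_iff.mp (Finset.mem_range.mp hi)), pow_succ]
        ring
      · simp
    rw [hsplit, hsplit] at h
    have hmod : u (r + 1) ≡ v (r + 1) [MOD a] := by
      refine Nat.ModEq.cancel_right_of_coprime (c := b ^ (r + 1)) (Nat.Coprime.pow_right _ hco) ?_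
      have := congrArg (· % a) h
      simpa [Nat.ModEq, Nat.add_mod] using this
    have hur := hu (r + 1) (Nat.succ_pos r) le_rfl
    obtain ⟨q, hq⟩ : ∃ q, v (r + 1) = u (r + 1) + a * q := by
      refine ⟨v (r + 1) / a, ?_⟩
      rw [← Nat.mod_eq_of_lt hur, hmod, Nat.mod_add_div]
    let v' : ℕ → ℕ := fun i => if i = r then v r + b * q else v i
    have hv' : ∀ c : ℕ → ℕ, ∑ i ∈ Finset.range (r + 1), v' i * c i =
        ∑ i ∈ Finset.range (r + 1), v i * c i + b * q * c r := by
      intro c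
      rw [Finset.sum_range_succ, Finset.sum_range_succ,
        Finset.sum_congr rfl fun i hi => by
          rw [show v' i = v i from if_neg (Finset.mem_range.mp hi).ne]]
      simp only [v', if_true]
      ring
    have hweight : ∑ i ∈ Finset.range (r + 1), u i * (a ^ (r - i) * b ^ i) =
        ∑ i ∈ Finset.range (r + 1), v' i * (a ^ (r - i) * b ^ i) := by
      rw [hv' fun i => a ^ (r - i) * b ^ i]
      refine Nat.eq_of_mul_eq_mul_left ha ?_
      rw [hq] at h
      simp only [Nat.sub_self, pow_zero, one_mul]
      rw [pow_succ] at h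
      linarith
    obtain ⟨hle, heq⟩ := ih v' (fun i h0 hi => hu i h0 (by omega)) hweight
    have hsum := hv' fun _ => 1
    simp only [mul_one] at hsum
    rw [Finset.sum_range_succ, Finset.sum_range_succ (fun i => u i), hq]
    have hqab : a * q ≤ b * q := Nat.mul_le_mul_right q hab.le
    refine ⟨by omega, fun hlen => ?_⟩
    have hq0 : q = 0 := by
      by_contra hne
      have := Nat.mul_lt_mul_of_pos_right hab (Nat.pos_of_ne_zero hne)
      omega
    subst hq0
    intro i hi
    rcases hi.lt_or_eq with hi | rfl
    · have h1 := heq (by omega) i (by omega)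
      by_cases hir : i = r <;> simp_all [v']
    · simpa using hq.symm

/-- A version of `geom_normal_factorization_longest` for exponent vectors. -/
theorem geom_normal_exponent_longest {a b r : ℕ} (ha : 0 < a) (hab : a < b)
    (hco : Nat.Coprime a b) (u v : Fin (r + 1) →₀ ℕ) (hu : ∀ i : Fin r, u i.succ < a)
    (h : ∑ i, u i * (a ^ (r - (i : ℕ)) * b ^ (i : ℕ)) =
      ∑ i, v i * (a ^ (r - (i : ℕ)) * b ^ (i : ℕ)))
    (hdeg : u.degree ≤ v.degree) : u = v := by
  let ext : (Fin (r + 1) →₀ ℕ) → ℕ → ℕ := fun w i => if h : i < r + 1 then w ⟨i, h⟩ else 0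
  have hext : ∀ (w : Fin (r + 1) →₀ ℕ) (i : Fin (r + 1)), ext w i = w i := by
    intro w i
    exact dif_pos i.isLt
  have key := geom_normal_factorization_longest ha hab hco r (ext u) (ext v)
    (by
      intro i h0 hi
      have h1 := hu ⟨i - 1, by omega⟩
      have h2 : (⟨i - 1, by omega⟩ : Fin r).succ = ⟨i, by omega⟩ := by
        ext
        simp
        omega
      rw [h2] at h1
      exact (hext u ⟨i, Nat.lt_succ_iff.mpr hi⟩).trans_lt h1)
    (by
      rw [Finset.sum_range, Finset.sum_range]
      simpa only [hext] using h)
  simp only [Finset.sum_range, hext] at key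
  rw [Finsupp.degree_eq_sum, Finsupp.degree_eq_sum] at hdeg
  ext i
  have := key.2 (le_antisymm key.1 hdeg) i (Nat.lt_succ_iff.mp i.isLt)
  simpa only [hext] using this

/-- The ideal `(z_2^a, …, z_{r+1}^a)`, which is the ideal of initial forms of the defining ideal
of a geometric sequence. -/
def geomPowIdeal (k : Type) [Field k] (a r : ℕ) : Ideal (MvPolynomial (Fin (r + 1)) k) :=
  Ideal.span ((fun s => monomial s (1 : k)) ''
    Set.range fun i : Fin r => Finsupp.single i.succ a)

theorem mem_geomPowIdeal_iff {k : Type} [Field k] {a r : ℕ} {f : MvPolynomial (Fin (r + 1)) k} :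
    f ∈ geomPowIdeal k a r ↔ ∀ u ∈ f.support, ∃ i : Fin r, a ≤ u i.succ := by
  rw [geomPowIdeal, mem_ideal_span_monomial_image]
  simp [Finsupp.single_le_iff]

theorem X_succ_pow_mem_geomPowIdeal {k : Type} [Field k] {a r : ℕ} (i : Fin r) :
    (X i.succ ^ a : MvPolynomial (Fin (r + 1)) k) ∈ geomPowIdeal k a r := by
  rw [X_pow_eq_monomial]
  exact Ideal.subset_span ⟨_, ⟨i, rfl⟩, rfl⟩

theorem initialForm_X_pow_sub_X_pow {k : Type} [Field k] {n a b : ℕ} (hab : a < b)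
    (i j : Fin n) :
    AffineSG.initialForm (X i ^ a - X j ^ b : MvPolynomial (Fin n) k) = X i ^ a := by
  have hne : Finsupp.single j b ≠ Finsupp.single i a := by
    intro h
    have := congrArg Finsupp.degree h
    simp only [Finsupp.degree_single] at this
    omega
  have hmin : AffineSG.minDeg (X i ^ a - X j ^ b : MvPolynomial (Fin n) k) = a := by
    have hmem : a ∈ AffineSG.edeg ''
        ((X i ^ a - X j ^ b : MvPolynomial (Fin n) k).support : Set (Fin n →₀ ℕ)) := by
      refine ⟨Finsupp.single i a, ?_, ?_⟩
      · simp [X_pow_eq_monomial, coeff_monomial, hne]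
      · exact Finsupp.degree_single i a
    refine le_antisymm (Nat.sInf_le hmem) (le_csInf ⟨a, hmem⟩ ?_)
    rintro _ ⟨u, hu, rfl⟩
    have hu' := support_sub _ _ _ hu
    simp only [X_pow_eq_monomial, Finset.mem_union] at hu'
    change a ≤ Finsupp.degree u
    rcases hu' with h | h
    · rw [Finset.mem_singleton.mp (support_monomial_subset h), Finsupp.degree_single]
    · rw [Finset.mem_singleton.mp (support_monomial_subset h), Finsupp.degree_single]
      exact hab.le
  rw [AffineSG.initialForm, hmin, map_sub,
    homogeneousComponent_of_mem (isHomogeneous_X_pow i a),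
    homogeneousComponent_of_mem (isHomogeneous_X_pow j b)]
  simp [hab.ne]

theorem geomP_mem_geomKer (k : Type) [Field k] {a b r : ℕ} (i : Fin r) :
    geomP k a b r i ∈ geomKer k a b r := by
  rw [geomKer, RingHom.mem_ker, geomP]
  simp only [map_sub, map_pow, aeval_X, ← pow_mul, sub_eq_zero]
  congr 1
  have : r - (i : ℕ) = r - (i + 1) + 1 := by omega
  simp only [Fin.val_succ, Fin.val_castSucc, this, pow_succ]
  ring

theorem starIdeal_geomKer (k : Type) [Field k] {a b r : ℕ} (ha : 0 < a) (hab : a < b)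
    (hco : Nat.Coprime a b) :
    AffineSG.starIdeal (geomKer k a b r) = geomPowIdeal k a r := by
  refine le_antisymm (Ideal.span_le.mpr ?_) (Ideal.span_le.mpr ?_)
  · rintro _ ⟨f, hf, -, rfl⟩
    rw [SetLike.mem_coe, mem_geomPowIdeal_iff]
    intro u hu
    by_contra! hnormal
    have hcoeff := mem_support_iff.mp hu
    rw [AffineSG.initialForm, coeff_homogeneousComponent] at hcoeff
    obtain ⟨hudeg, hcoeff⟩ := ite_ne_right_iff.mp hcoeff
    have hmin : ∀ v ∈ f.support, u.degree ≤ v.degree := fun v hv =>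
      hudeg.trans_le (Nat.sInf_le ⟨v, hv, rfl⟩)
    rw [geomKer, RingHom.mem_ker] at hf
    have haeval : ∀ v : Fin (r + 1) →₀ ℕ,
        ∏ i : Fin (r + 1), ((Polynomial.X : Polynomial k) ^ (a ^ (r - (i : ℕ)) * b ^ (i : ℕ))) ^ v i =
          Polynomial.X ^ ∑ i, v i * (a ^ (r - (i : ℕ)) * b ^ (i : ℕ)) := by
      intro v
      rw [← Finset.prod_pow_eq_pow_sum]
      refine Finset.prod_congr rfl fun i _ => ?_
      rw [← pow_mul, mul_comm]
    have h0 := congrArg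
      (Polynomial.coeff · (∑ i, u i * (a ^ (r - (i : ℕ)) * b ^ (i : ℕ)))) hf
    simp only [aeval_def, eval₂_eq', haeval, Polynomial.algebraMap_eq,
      Polynomial.finsetSum_coeff, Polynomial.coeff_C_mul, Polynomial.coeff_X_pow,
      Polynomial.coeff_zero] at h0
    rw [Finset.sum_eq_single u] at h0
    · simp [hcoeff] at h0
    · intro v hv hvu
      rw [if_neg, mul_zero]
      exact fun h =>
        hvu (geom_normal_exponent_longest ha hab hco u v hnormal h (hmin v hv)).symm
    · intro h
      exact absurd (mem_support_iff.mpr hcoeff) h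
  · rintro _ ⟨_, ⟨i, rfl⟩, rfl⟩
    have hform := initialForm_X_pow_sub_X_pow (k := k) hab i.succ i.castSucc
    refine Ideal.subset_span ⟨_, geomP_mem_geomKer k i, ?_, ?_⟩
    · intro h
      rw [← geomP, h, AffineSG.initialForm, map_zero] at hform
      exact pow_ne_zero a (X_ne_zero _) hform.symm
    · rw [geomP, hform, X_pow_eq_monomial]

/-- Two rings have the same Krull dimension if there is a split surjection between them whose
section is also an inverse up to nilpotent elements. -/
theorem ringKrullDim_eq_of_leftInverse_of_sub_mem_nilradical {R S : Type*} [CommRing R]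
    [CommRing S] (f : R →+* S) (g : S →+* R) (hfg : Function.LeftInverse f g)
    (hgf : ∀ x, x - g (f x) ∈ nilradical R) : ringKrullDim R = ringKrullDim S := by
  refine le_antisymm (Order.krullDim_le_of_strictMono (PrimeSpectrum.comap g) ?_)
    (ringKrullDim_le_of_surjective f hfg.surjective)
  refine Monotone.strictMono_of_injective (fun _ _ h => Ideal.comap_mono h) fun P Q h => ?_
  have key : ∀ (P : PrimeSpectrum R) (x : R),
      x ∈ P.asIdeal ↔ f x ∈ (PrimeSpectrum.comap g P).asIdeal := by
    intro P x
    have hx := nilradical_le_prime P.asIdeal (hgf x)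
    exact ⟨fun h => (Submodule.sub_mem_iff_right _ h).mp hx,
      fun h => (Submodule.sub_mem_iff_left _ (show g (f x) ∈ P.asIdeal from h)).mp hx⟩
  ext x
  rw [key, key, h]

theorem ringKrullDim_quotient_geomPowIdeal (k : Type) [Field k] {a r : ℕ} (ha : 0 < a) :
    ringKrullDim (MvPolynomial (Fin (r + 1)) k ⧸ geomPowIdeal k a r) = 1 := by
  rw [← IsPrincipalIdealRing.ringKrullDim_eq_one (Polynomial k) (Polynomial.not_isField k)]
  let φ : MvPolynomial (Fin (r + 1)) k →ₐ[k] Polynomial k :=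
    aeval (Fin.cons Polynomial.X fun _ => 0)
  let f : (MvPolynomial (Fin (r + 1)) k ⧸ geomPowIdeal k a r) →ₐ[k] Polynomial k :=
    Ideal.Quotient.liftₐ _ φ (by
      intro x hx
      have hle : geomPowIdeal k a r ≤ RingHom.ker φ := by
        refine Ideal.span_le.mpr ?_
        rintro _ ⟨_, ⟨i, rfl⟩, rfl⟩
        simp [φ, ← X_pow_eq_monomial, RingHom.mem_ker, ha.ne']
      exact hle hx)
  let g : Polynomial k →ₐ[k] (MvPolynomial (Fin (r + 1)) k ⧸ geomPowIdeal k a r) :=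
    Polynomial.aeval (Ideal.Quotient.mk _ (X 0))
  have hf : ∀ p, f (Ideal.Quotient.mk _ p) = φ p := fun p => rfl
  refine ringKrullDim_eq_of_leftInverse_of_sub_mem_nilradical f.toRingHom g.toRingHom ?_ ?_
  · have : f.comp g = AlgHom.id k _ := by
      ext
      simp [g, hf, φ]
    exact fun p => DFunLike.congr_fun this p
  · let π := Ideal.Quotient.mkₐ k
      (nilradical (MvPolynomial (Fin (r + 1)) k ⧸ geomPowIdeal k a r))
    have hπ : (π.comp (g.comp φ)) = π.comp (Ideal.Quotient.mkₐ k (geomPowIdeal k a r)) := by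
      ext i
      refine Fin.cases ?_ (fun i => ?_) i
      · simp [φ, g]
      · simp only [φ, AlgHom.comp_apply, aeval_X, Fin.cons_succ, map_zero]
        refine (Ideal.Quotient.eq_zero_iff_mem.mpr ?_).symm
        refine mem_nilradical.mpr ⟨a, ?_⟩
        rw [← map_pow]
        exact Ideal.Quotient.eq_zero_iff_mem.mpr (X_succ_pow_mem_geomPowIdeal i)
    intro x
    obtain ⟨p, rfl⟩ := Ideal.Quotient.mk_surjective x
    exact Ideal.Quotient.eq.mp (DFunLike.congr_fun hπ p).symm

theorem isRegular_X_zero_geomPowIdeal (k : Type) [Field k] {a r : ℕ} (ha : 0 < a) :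
    RingTheory.Sequence.IsRegular (MvPolynomial (Fin (r + 1)) k ⧸ geomPowIdeal k a r)
      [Ideal.Quotient.mk (geomPowIdeal k a r) (X 0)] := by
  refine ⟨(RingTheory.Sequence.isWeaklyRegular_singleton_iff _ _).mpr ?_, ?_⟩
  · rw [isSMulRegular_iff_right_eq_zero_of_smul]
    intro x hx
    obtain ⟨p, rfl⟩ := Ideal.Quotient.mk_surjective x
    rw [smul_eq_mul, ← map_mul, Ideal.Quotient.eq_zero_iff_mem, mem_geomPowIdeal_iff] at hx
    rw [Ideal.Quotient.eq_zero_iff_mem, mem_geomPowIdeal_iff]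
    intro u hu
    obtain ⟨i, hi⟩ := hx (Finsupp.single 0 1 + u) (by
      rw [mem_support_iff, coeff_X_mul]
      exact mem_support_iff.mp hu)
    exact ⟨i, by simpa using hi⟩
  · rw [Ideal.ofList_singleton, smul_eq_mul, Ideal.mul_top]
    intro h
    have h1 := h ▸ Submodule.mem_top (x := 1)
    obtain ⟨y, hy⟩ := Ideal.mem_span_singleton.mp h1
    obtain ⟨p, rfl⟩ := Ideal.Quotient.mk_surjective y
    rw [← map_mul, ← map_one (Ideal.Quotient.mk _), Ideal.Quotient.eq,
      mem_geomPowIdeal_iff] at hy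
    obtain ⟨i, hi⟩ := hy 0 (by simp [mem_support_iff, ← constantCoeff_eq])
    simp at hi
    omega

open AffineSG MvPolynomial in
/-- For the numerical semigroup minimally generated by the geometric sequence
`a^r, a^{r-1}b, …, b^r` (`gcd(a,b) = 1`, `a < b`), the associated graded ring
`gr_𝔪(k[S]) ≅ A/𝔭*` of the semigroup ring is Cohen–Macaulay. -/
theorem geom_assocGraded_CM {k : Type} [Field k] (a b r : ℕ)
    (ha : 0 < a) (hab : a < b) (hco : Nat.Coprime a b) (hr : 0 < r) :
    IsCM (MvPolynomial (Fin (r + 1)) k ⧸ starIdeal (geomKer k a b r))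
      (quotMax (starIdeal (geomKer k a b r))) := by
  rw [starIdeal_geomKer k ha hab hco]
  refine ⟨[Ideal.Quotient.mk _ (X 0)], ?_, isRegular_X_zero_geomPowIdeal k ha, ?_⟩
  · simp only [List.mem_singleton, forall_eq]
    exact Ideal.mem_map_of_mem _ (Ideal.subset_span ⟨0, rfl⟩)
  · simpa using ringKrullDim_quotient_geomPowIdeal k ha
end
end
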